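/- Basic tangential energy estimate: there exist a constant C > 0 and polynomial functions P₀, P with nonnegative coefficients, depending only on Ω, C₁, C₂ and ‖ρ₀‖_{H⁷(Ω)}, such that for every smooth solution (v,η) of the Lagrangian system on Ω×[0,T] with initial data u₀ = v(·,0) and satisfying the a priori assumption, one has for all t ∈ [0,T]: Σ_{l₀=0}^{4} ∫_Ω ρ₀|∂_t^{l₀}v|²(t) dx + ∫₀ᵗ∫_Ω ρ₀|∂_t⁴Dv|² dx ds ≤ P₀(E(0,u₀)) + C t P(sup_{0≤s≤t} E(s,v)^{1/2}). -/

import Mathlib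

open MeasureTheory Real Filter

noncomputable section

/-- The reference domain `Ω = 𝕋 × (0,1)`, realized as the fundamental square `(0,1) × (0,1)`. -/
def Oset : Set (ℝ × ℝ) := Set.Ioo (0:ℝ) 1 ×ˢ Set.Ioo (0:ℝ) 1

/-- The vacuum boundary `Γ = 𝕋 × {0,1}`. -/
def Gset : Set (ℝ × ℝ) := {x : ℝ × ℝ | x.2 = 0 ∨ x.2 = 1}

/-- Distance to the boundary `Γ`. -/
def distG (x : ℝ × ℝ) : ℝ := min x.2 (1 - x.2)

variable {F : Type*} [NormedAddCommGroup F] [NormedSpace ℝ F]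

/-- Horizontal partial derivative `∂₁`. -/
def pd1 (f : ℝ × ℝ → F) : ℝ × ℝ → F := fun x => fderiv ℝ f x (1, 0)

/-- Vertical (normal) partial derivative `∂₂`. -/
def pd2 (f : ℝ × ℝ → F) : ℝ × ℝ → F := fun x => fderiv ℝ f x (0, 1)

/-- Time derivative `∂ₜ`. -/
def pdt (v : ℝ → ℝ × ℝ → F) : ℝ → ℝ × ℝ → F := fun t x => deriv (fun s => v s x) t

/-- `|Df|²` at a point. -/
def gradSq (f : ℝ × ℝ → F) (x : ℝ × ℝ) : ℝ := ‖pd1 f x‖ ^ 2 + ‖pd2 f x‖ ^ 2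

/-- 1-periodicity in the horizontal variable (functions on the torus `𝕋 × (0,1)`). -/
def Per (f : ℝ × ℝ → F) : Prop := ∀ x : ℝ × ℝ, f (x.1 + 1, x.2) = f x

/-- Smoothness. -/
def SmoothFn (f : ℝ × ℝ → F) : Prop := ∀ n : ℕ, ContDiff ℝ n f

/-- Joint smoothness of a time dependent family. -/
def SmoothT (v : ℝ → ℝ × ℝ → F) : Prop :=
  ∀ n : ℕ, ContDiff ℝ n (fun p : ℝ × (ℝ × ℝ) => v p.1 p.2)

def PerT (v : ℝ → ℝ × ℝ → F) : Prop := ∀ t : ℝ, Per (v t)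

/-- Admissible initial depth profile: smooth, periodic, vanishing on `Γ` and
comparable to the distance to the boundary. -/
def IsDensity (C₁ C₂ : ℝ) (ρ₀ : ℝ × ℝ → ℝ) : Prop :=
  SmoothFn ρ₀ ∧ Per ρ₀ ∧ (∀ x ∈ Gset, ρ₀ x = 0) ∧
    ∀ x ∈ Oset, C₁ * distG x ≤ ρ₀ x ∧ ρ₀ x ≤ C₂ * distG x

/-- The higher-order energy functional `E(t,v)`. -/
def energy (ρ₀ : ℝ × ℝ → ℝ) (v : ℝ → ℝ × ℝ → ℝ × ℝ) (t : ℝ) : ℝ :=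
  (∑ l₀ ∈ Finset.range 5, ∫ x in Oset, ρ₀ x * ‖(pdt^[l₀] v) t x‖ ^ 2)
    + (∑ l₀ ∈ Finset.range 4, ∑ l₁ ∈ Finset.range (7 - 2 * l₀),
        ∫ x in Oset, ρ₀ x *
          (gradSq (pd1^[l₁] ((pdt^[l₀] v) t)) x + gradSq (pd1^[l₁ + 1] ((pdt^[l₀] v) t)) x))
    + ∑ l₀ ∈ Finset.range 4, ∑ l₁ ∈ Finset.range (7 - 2 * l₀),
        ∑ l₂ ∈ Finset.Icc 2 (8 - 2 * l₀ - l₁),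
          ∫ x in Oset, ρ₀ x ^ l₂ * ‖(pd1^[l₁] (pd2^[l₂] ((pdt^[l₀] v) t))) x‖ ^ 2

/-- The Lagrangian flow map `η(x,t) = x + ∫₀ᵗ v(x,s) ds`. -/
def flowMap (v : ℝ → ℝ × ℝ → ℝ × ℝ) (t : ℝ) (x : ℝ × ℝ) : ℝ × ℝ :=
  x + ∫ s in (0:ℝ)..t, v s x

/-- The (squared-sum) Sobolev `H^k(Ω)` norm. -/
def sobolevNorm (k : ℕ) (f : ℝ × ℝ → F) : ℝ :=
  Real.sqrt (∑ θ ∈ Finset.range (k + 1), ∫ x in Oset, ‖iteratedFDeriv ℝ θ f x‖ ^ 2)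

/-- `sup_{0 ≤ s ≤ t} E(s,v)^{1/2}`. -/
def supEn (ρ₀ : ℝ × ℝ → ℝ) (v : ℝ → ℝ × ℝ → ℝ × ℝ) (t : ℝ) : ℝ :=
  ⨆ s : Set.Icc (0:ℝ) t, Real.sqrt (energy ρ₀ v ↑s)

/-- Weighted `L²(Ω)` norm `‖ρ₀^p ∂₁^{l₁} D^k f‖_{L²(Ω)}`. -/
def wL2 (ρ₀ : ℝ × ℝ → ℝ) (p k l₁ : ℕ) (f : ℝ × ℝ → F) : ℝ :=
  Real.sqrt (∫ x in Oset, (ρ₀ x ^ p * ‖iteratedFDeriv ℝ k (pd1^[l₁] f) x‖) ^ 2)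

/-- Weighted `L^∞(Ω)` norm `‖ρ₀^p ∂₁^{l₁} D^k f‖_{L^∞(Ω)}`. -/
def wSup (ρ₀ : ℝ × ℝ → ℝ) (p k l₁ : ℕ) (f : ℝ × ℝ → F) : ℝ :=
  ⨆ x : Oset, ρ₀ (x : ℝ × ℝ) ^ p * ‖iteratedFDeriv ℝ k (pd1^[l₁] f) (x : ℝ × ℝ)‖

def pick (i : Fin 2) (w : ℝ × ℝ) : ℝ := if i = 0 then w.1 else w.2

def evec (k : Fin 2) : ℝ × ℝ := if k = 0 then (1, 0) else (0, 1)

def pdk (k : Fin 2) (f : ℝ × ℝ → ℝ) : ℝ × ℝ → ℝ := fun x => fderiv ℝ f x (evec k)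

/-- The cofactor matrix `a` of `Dη`, `a = [[∂₂η², −∂₂η¹], [−∂₁η², ∂₁η¹]]`,
indexed so that `cof η x i k = a_i^k`. -/
def cof (η : ℝ × ℝ → ℝ × ℝ) (x : ℝ × ℝ) (i k : Fin 2) : ℝ :=
  if i = 0 then
    (if k = 0 then pd2 (fun y => (η y).2) x else -pd1 (fun y => (η y).2) x)
  else
    (if k = 0 then -pd2 (fun y => (η y).1) x else pd1 (fun y => (η y).1) x)

/-- The Jacobian determinant `J = det Dη`. -/
def jac (η : ℝ × ℝ → ℝ × ℝ) (x : ℝ × ℝ) : ℝ :=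
  pd1 (fun y => (η y).1) x * pd2 (fun y => (η y).2) x
    - pd2 (fun y => (η y).1) x * pd1 (fun y => (η y).2) x

/-- `b^{kj} = a_l^k a_l^j`. -/
def bmat (η : ℝ × ℝ → ℝ × ℝ) (x : ℝ × ℝ) (k j : Fin 2) : ℝ :=
  ∑ l : Fin 2, cof η x l k * cof η x l j

/-- `(v,η)` is a (classical) solution of the Lagrangian system
`ρ₀ ∂ₜ v^i + (ρ₀² J⁻² a_i^k),_k = (ρ₀ J⁻² b^{kj} v^i,_j),_k` in `Ω × (0,T]`. -/
def IsLagSol (ρ₀ : ℝ × ℝ → ℝ) (v : ℝ → ℝ × ℝ → ℝ × ℝ) (T : ℝ) : Prop :=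
  ∀ t : ℝ, 0 < t → t ≤ T → ∀ x ∈ Oset, ∀ i : Fin 2,
    ρ₀ x * pick i (pdt v t x)
        + ∑ k : Fin 2, pdk k
            (fun y => ρ₀ y ^ 2 * jac (flowMap v t) y ^ (-2 : ℤ) * cof (flowMap v t) y i k) x
      = ∑ k : Fin 2, pdk k
          (fun y => ρ₀ y * jac (flowMap v t) y ^ (-2 : ℤ) *
            ∑ j : Fin 2, bmat (flowMap v t) y k j * pdk j (fun z => pick i (v t z)) y) x

/-- The a priori assumption: `sup_{0≤t≤T} E(t,v) ≤ M₁`,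
`T ∈ (0, 1/(20c₁c₂√M₁ + 10c₁²c₂²M₁)] ∩ (0,1)`, where `c₁, c₂` are the constants of the
embedding inequalities, so that in particular `‖Dv‖_{L^∞} ≤ c₁c₂ E^{1/2}`. -/
def Apriori (ρ₀ : ℝ × ℝ → ℝ) (v : ℝ → ℝ × ℝ → ℝ × ℝ) (T M₁ c₁ c₂ : ℝ) : Prop :=
  0 < c₁ ∧ 0 < c₂ ∧ 0 ≤ M₁ ∧ 0 < T ∧ T ≤ 1 ∧
    T ≤ 1 / (20 * c₁ * c₂ * Real.sqrt M₁ + 10 * c₁ ^ 2 * c₂ ^ 2 * M₁) ∧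
    (∀ t ∈ Set.Icc (0:ℝ) T, energy ρ₀ v t ≤ M₁) ∧
    ∀ t ∈ Set.Icc (0:ℝ) T, ∀ x ∈ Oset,
      ‖fderiv ℝ (v t) x‖ ≤ c₁ * c₂ * Real.sqrt (energy ρ₀ v t)

/-- Smooth test functions compactly supported in `Ω`. -/
def CinfTest (φ : ℝ × ℝ → ℝ) : Prop :=
  (∀ n : ℕ, ContDiff ℝ n φ) ∧ HasCompactSupport φ ∧ tsupport φ ⊆ Oset

/-- `g` is the weak directional derivative of `u` in direction `e` on `Ω`. -/
def WeakPD (e : ℝ × ℝ) (u g : ℝ × ℝ → ℝ) : Prop :=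
  ∀ φ : ℝ × ℝ → ℝ, CinfTest φ →
    ∫ x in Oset, u x * fderiv ℝ φ x e = -∫ x in Oset, g x * φ x

/-- Membership in the weighted space `H¹_{ρ₀}(Ω)`, with weak gradient `Dw`. -/
def InH1w (ρ₀ : ℝ × ℝ → ℝ) (w : ℝ × ℝ → ℝ) (Dw : ℝ × ℝ → ℝ × ℝ) : Prop :=
  AEStronglyMeasurable w (volume.restrict Oset) ∧
    AEStronglyMeasurable Dw (volume.restrict Oset) ∧
    IntegrableOn (fun x => ρ₀ x * (w x) ^ 2) Oset ∧
    IntegrableOn (fun x => ρ₀ x * ‖Dw x‖ ^ 2) Oset ∧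
    WeakPD (1, 0) w (fun x => (Dw x).1) ∧ WeakPD (0, 1) w (fun x => (Dw x).2)

/-- The bilinear form `B[w,φ]_μ = ∫_Ω ρ₀ (Dw·Dφ + wφ) dx`. -/
def Bform (ρ₀ : ℝ × ℝ → ℝ) (w : ℝ × ℝ → ℝ) (Dw : ℝ × ℝ → ℝ × ℝ)
    (φ : ℝ × ℝ → ℝ) (Dφ : ℝ × ℝ → ℝ × ℝ) : ℝ :=
  ∫ x in Oset, ρ₀ x * ((Dw x).1 * (Dφ x).1 + (Dw x).2 * (Dφ x).2 + w x * φ x)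

/-! ### Part 1: smooth calculus -/
open scoped ContDiff

lemma smoothT_iff {G : Type*} [NormedAddCommGroup G] [NormedSpace ℝ G] {f : ℝ → ℝ × ℝ → G} :
    SmoothT f ↔ ContDiff ℝ ∞ (fun p : ℝ × (ℝ × ℝ) => f p.1 p.2) := contDiff_infty.symm

lemma smoothFn_iff {G : Type*} [NormedAddCommGroup G] [NormedSpace ℝ G] {f : ℝ × ℝ → G} :
    SmoothFn f ↔ ContDiff ℝ ∞ f := contDiff_infty.symm

lemma contDiff_dir {E G : Type*} [NormedAddCommGroup E] [NormedSpace ℝ E]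
    [NormedAddCommGroup G] [NormedSpace ℝ G] {f : E → G} (hf : ContDiff ℝ ∞ f) (u : E) :
    ContDiff ℝ ∞ (fun x => fderiv ℝ f x u) := by
  have h : ContDiff ℝ ∞ (fderiv ℝ f) := hf.fderiv_right (m := ∞) (by simp)
  exact h.clm_apply contDiff_const

lemma dir_comm {E G : Type*} [NormedAddCommGroup E] [NormedSpace ℝ E]
    [NormedAddCommGroup G] [NormedSpace ℝ G] {f : E → G} (hf : ContDiff ℝ ∞ f) (u w x : E) :
    fderiv ℝ (fun y => fderiv ℝ f y u) x w = fderiv ℝ (fun y => fderiv ℝ f y w) x u := by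
  have hd : DifferentiableAt ℝ (fderiv ℝ f) x :=
    (hf.fderiv_right (m := ∞) (by simp)).differentiable (by simp) x
  have hs : IsSymmSndFDerivAt ℝ f x := by
    apply hf.contDiffAt.isSymmSndFDerivAt
    simp only [minSmoothness_of_isRCLikeNormedField]
    exact WithTop.coe_le_coe.2 (le_top : (2 : ℕ∞) ≤ ⊤)
  rw [fderiv_clm_apply hd (differentiableAt_const u), fderiv_clm_apply hd (differentiableAt_const w)]
  simp
  exact hs w u

lemma SmoothT.smoothFn {G : Type*} [NormedAddCommGroup G] [NormedSpace ℝ G]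
    {f : ℝ → ℝ × ℝ → G} (hf : SmoothT f) (t : ℝ) : SmoothFn (f t) := by
  rw [smoothT_iff] at hf
  rw [smoothFn_iff]
  exact hf.comp (contDiff_const.prodMk contDiff_id)

lemma SmoothT.contDiff_time {G : Type*} [NormedAddCommGroup G] [NormedSpace ℝ G]
    {f : ℝ → ℝ × ℝ → G} (hf : SmoothT f) (x : ℝ × ℝ) : ContDiff ℝ ∞ (fun s => f s x) := by
  rw [smoothT_iff] at hf
  exact hf.comp (contDiff_id.prodMk contDiff_const)

lemma SmoothT.continuous {G : Type*} [NormedAddCommGroup G] [NormedSpace ℝ G]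
    {f : ℝ → ℝ × ℝ → G} (hf : SmoothT f) : Continuous (fun p : ℝ × (ℝ × ℝ) => f p.1 p.2) :=
  (smoothT_iff.1 hf).continuous

lemma SmoothFn.continuous' {G : Type*} [NormedAddCommGroup G] [NormedSpace ℝ G]
    {f : ℝ × ℝ → G} (hf : SmoothFn f) : Continuous f := (smoothFn_iff.1 hf).continuous

lemma pdt_eq {G : Type*} [NormedAddCommGroup G] [NormedSpace ℝ G]
    {f : ℝ → ℝ × ℝ → G} (hf : SmoothT f) (t : ℝ) (x : ℝ × ℝ) :
    pdt f t x = fderiv ℝ (fun p : ℝ × (ℝ × ℝ) => f p.1 p.2) (t, x) (1, 0) := by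
  rw [smoothT_iff] at hf
  have h1 : HasFDerivAt (fun p : ℝ × (ℝ × ℝ) => f p.1 p.2)
      (fderiv ℝ (fun p : ℝ × (ℝ × ℝ) => f p.1 p.2) (t, x)) (t, x) :=
    (hf.differentiable (by simp) _).hasFDerivAt
  have h2 : HasDerivAt (fun s : ℝ => ((s, x) : ℝ × (ℝ × ℝ))) (1, 0) t :=
    (hasDerivAt_id t).prodMk (hasDerivAt_const t x)
  exact (h1.comp_hasDerivAt t h2).deriv

lemma fderiv_slice {G : Type*} [NormedAddCommGroup G] [NormedSpace ℝ G]
    {f : ℝ → ℝ × ℝ → G} (hf : SmoothT f) (t : ℝ) (x e : ℝ × ℝ) :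
    fderiv ℝ (f t) x e = fderiv ℝ (fun p : ℝ × (ℝ × ℝ) => f p.1 p.2) (t, x) (0, e) := by
  rw [smoothT_iff] at hf
  have h1 : HasFDerivAt (fun p : ℝ × (ℝ × ℝ) => f p.1 p.2)
      (fderiv ℝ (fun p : ℝ × (ℝ × ℝ) => f p.1 p.2) (t, x)) (t, x) :=
    (hf.differentiable (by simp) _).hasFDerivAt
  have h2 : HasFDerivAt (fun y : ℝ × ℝ => ((t, y) : ℝ × (ℝ × ℝ))) _ x :=
    (hasFDerivAt_const (𝕜 := ℝ) t x).prodMk (hasFDerivAt_id x)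
  have h3 := h1.comp x h2
  have h4 : fderiv ℝ (f t) x = _ := h3.fderiv
  rw [h4]
  simp

/-- time-dependent directional derivative -/
def sdir {G : Type*} [NormedAddCommGroup G] [NormedSpace ℝ G] (e : ℝ × ℝ)
    (f : ℝ → ℝ × ℝ → G) : ℝ → ℝ × ℝ → G := fun t x => fderiv ℝ (f t) x e

lemma SmoothT.pdt {G : Type*} [NormedAddCommGroup G] [NormedSpace ℝ G]
    {f : ℝ → ℝ × ℝ → G} (hf : SmoothT f) : SmoothT (pdt f) := by
  rw [smoothT_iff]
  have : (fun p : ℝ × (ℝ × ℝ) => _root_.pdt f p.1 p.2) =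
      fun p => fderiv ℝ (fun p : ℝ × (ℝ × ℝ) => f p.1 p.2) p (1, 0) := by
    funext p; exact pdt_eq hf p.1 p.2
  rw [this]
  exact contDiff_dir (smoothT_iff.1 hf) _

lemma SmoothT.sdir {G : Type*} [NormedAddCommGroup G] [NormedSpace ℝ G]
    {f : ℝ → ℝ × ℝ → G} (hf : SmoothT f) (e : ℝ × ℝ) : SmoothT (sdir e f) := by
  rw [smoothT_iff]
  have : (fun p : ℝ × (ℝ × ℝ) => _root_.sdir e f p.1 p.2) =
      fun p => fderiv ℝ (fun p : ℝ × (ℝ × ℝ) => f p.1 p.2) p (0, e) := by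
    funext p; exact fderiv_slice hf p.1 p.2 e
  rw [this]
  exact contDiff_dir (smoothT_iff.1 hf) _

lemma pdt_sdir {G : Type*} [NormedAddCommGroup G] [NormedSpace ℝ G]
    {f : ℝ → ℝ × ℝ → G} (hf : SmoothT f) (e : ℝ × ℝ) : pdt (sdir e f) = sdir e (pdt f) := by
  funext t x
  rw [pdt_eq (hf.sdir e)]
  unfold sdir
  rw [fderiv_slice hf.pdt]
  have h1 : (fun p : ℝ × (ℝ × ℝ) => fderiv ℝ (f p.1) p.2 e) =
      fun p => fderiv ℝ (fun p : ℝ × (ℝ × ℝ) => f p.1 p.2) p (0, e) := by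
    funext p; exact fderiv_slice hf p.1 p.2 e
  have h2 : (fun p : ℝ × (ℝ × ℝ) => pdt f p.1 p.2) =
      fun p => fderiv ℝ (fun p : ℝ × (ℝ × ℝ) => f p.1 p.2) p (1, 0) := by
    funext p; exact pdt_eq hf p.1 p.2
  rw [h1, h2]
  exact dir_comm (smoothT_iff.1 hf) _ _ _

lemma SmoothT.pdt_iter {G : Type*} [NormedAddCommGroup G] [NormedSpace ℝ G]
    {f : ℝ → ℝ × ℝ → G} (hf : SmoothT f) (n : ℕ) : SmoothT (_root_.pdt^[n] f) := by
  induction n with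
  | zero => exact hf
  | succ n ih => rw [Function.iterate_succ_apply']; exact ih.pdt

lemma pdt_iter_sdir {G : Type*} [NormedAddCommGroup G] [NormedSpace ℝ G]
    {f : ℝ → ℝ × ℝ → G} (hf : SmoothT f) (e : ℝ × ℝ) (n : ℕ) :
    pdt^[n] (sdir e f) = sdir e (pdt^[n] f) := by
  induction n with
  | zero => rfl
  | succ n ih =>
    rw [Function.iterate_succ_apply', Function.iterate_succ_apply', ih, pdt_sdir (hf.pdt_iter n)]

lemma pdt_iter_eq {G : Type*} [NormedAddCommGroup G] [NormedSpace ℝ G]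
    (f : ℝ → ℝ × ℝ → G) (n : ℕ) (t : ℝ) (x : ℝ × ℝ) :
    (pdt^[n] f) t x = iteratedDeriv n (fun s => f s x) t := by
  induction n generalizing t with
  | zero => simp
  | succ n ih =>
    rw [Function.iterate_succ_apply', iteratedDeriv_succ]
    unfold pdt
    congr 1
    funext s
    exact ih s

/-- coordinate projections as continuous linear maps -/
def pickL (i : Fin 2) : ℝ × ℝ →L[ℝ] ℝ :=
  if i = 0 then ContinuousLinearMap.fst ℝ ℝ ℝ else ContinuousLinearMap.snd ℝ ℝ ℝ

lemma pickL_apply (i : Fin 2) (w : ℝ × ℝ) : pickL i w = pick i w := by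
  unfold pickL pick; split_ifs <;> rfl

/-- components -/
def vcmp (i : Fin 2) (v : ℝ → ℝ × ℝ → ℝ × ℝ) : ℝ → ℝ × ℝ → ℝ := fun t x => pick i (v t x)

lemma SmoothT.vcmp {v : ℝ → ℝ × ℝ → ℝ × ℝ} (hv : SmoothT v) (i : Fin 2) : SmoothT (vcmp i v) := by
  rw [smoothT_iff] at *
  have := (pickL i).contDiff (n := ∞) |>.comp hv
  have e : (fun p : ℝ × (ℝ × ℝ) => _root_.vcmp i v p.1 p.2) =
      (pickL i) ∘ (fun p : ℝ × (ℝ × ℝ) => v p.1 p.2) := by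
    funext p; simp [pickL_apply, _root_.vcmp]
  rw [e]
  exact this

lemma pick_fderiv {f : ℝ × ℝ → ℝ × ℝ} {x : ℝ × ℝ} (hf : DifferentiableAt ℝ f x) (i : Fin 2)
    (e : ℝ × ℝ) : fderiv ℝ (fun y => pick i (f y)) x e = pick i (fderiv ℝ f x e) := by
  have h := ((pickL i).hasFDerivAt (x := f x)).comp x hf.hasFDerivAt
  have h' : fderiv ℝ (fun y => pick i (f y)) x = (pickL i).comp (fderiv ℝ f x) := by
    rw [← h.fderiv]
    congr 1
    funext y
    simp [pickL_apply]
  rw [h']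
  simp [pickL_apply]

lemma pdt_cmp {v : ℝ → ℝ × ℝ → ℝ × ℝ} (hv : SmoothT v) (i : Fin 2) :
    pdt (vcmp i v) = vcmp i (pdt v) := by
  funext t x
  have hd : HasDerivAt (fun s => v s x) (pdt v t x) t :=
    ((hv.contDiff_time x).differentiable (by simp) t).hasDerivAt
  have h := ((pickL i).hasFDerivAt (x := v t x)).comp_hasDerivAt t hd
  have h2 : HasDerivAt (fun s => vcmp i v s x) (pick i (pdt v t x)) t := by
    have e : (fun s => vcmp i v s x) = (pickL i) ∘ (fun s => v s x) := by
      funext s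
      simp [pickL_apply, vcmp]
    rw [← pickL_apply, e]
    exact h
  exact h2.deriv

lemma pdt_iter_cmp {v : ℝ → ℝ × ℝ → ℝ × ℝ} (hv : SmoothT v) (i : Fin 2) (n : ℕ) :
    pdt^[n] (vcmp i v) = vcmp i (pdt^[n] v) := by
  induction n with
  | zero => rfl
  | succ n ih =>
    rw [Function.iterate_succ_apply', Function.iterate_succ_apply', ih, pdt_cmp (hv.pdt_iter n)]

lemma sdir_cmp {v : ℝ → ℝ × ℝ → ℝ × ℝ} (hv : SmoothT v) (i : Fin 2) (e : ℝ × ℝ) :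
    sdir e (vcmp i v) = vcmp i (sdir e v) := by
  funext t x
  exact pick_fderiv ((smoothFn_iff.1 (hv.smoothFn t)).differentiable (by simp) x) i e

lemma abs_pick_le (i : Fin 2) (w : ℝ × ℝ) : |pick i w| ≤ ‖w‖ := by
  unfold pick; split_ifs
  · exact norm_fst_le w
  · exact norm_snd_le w

lemma norm_sq_le_pick (w : ℝ × ℝ) : ‖w‖ ^ 2 ≤ pick 0 w ^ 2 + pick 1 w ^ 2 := by
  simp only [pick, Prod.norm_def, Real.norm_eq_abs]
  rcases max_choice |w.1| |w.2| with h | h <;> rw [h] <;> simp <;> positivity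

/-- parametric integrals of smooth functions -/
lemma contDiff_param {E : Type} [NormedAddCommGroup E] [NormedSpace ℝ E] [FiniteDimensional ℝ E]
    (n : ℕ) : ∀ {G : Type} [NormedAddCommGroup G] [NormedSpace ℝ G] [CompleteSpace G]
    (g : E × ℝ → G), ContDiff ℝ n g → ContDiff ℝ n (fun p => ∫ θ in (0:ℝ)..1, g (p, θ)) := by
  induction n with
  | zero =>
    intro G _ _ _ g hg
    have hc : Continuous g := hg.continuous
    apply contDiff_zero.2
    apply intervalIntegral.continuous_parametric_intervalIntegral_of_continuous'
      (f := fun p θ => g (p, θ))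
    exact hc
  | succ n ih =>
    intro G _ _ _ g hg
    have hg1 : ContDiff ℝ n (fderiv ℝ g) := hg.fderiv_right (m := n) (by norm_cast)
    have hgc : Continuous g := hg.continuous
    set g' : E × ℝ → (E →L[ℝ] G) := fun q => (fderiv ℝ g q).comp (ContinuousLinearMap.inl ℝ E ℝ)
      with hg'
    have hg'1 : ContDiff ℝ n g' := hg1.clm_comp contDiff_const
    have hg'c : Continuous g' := hg'1.continuous
    have hd : ∀ p θ, HasFDerivAt (fun p => g (p, θ)) (g' (p, θ)) p := by
      intro p θ
      have h1 : HasFDerivAt g (fderiv ℝ g (p, θ)) (p, θ) :=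
        (hg.differentiable (by simp) _).hasFDerivAt
      exact h1.comp p (hasFDerivAt_prodMk_left p θ)
    have key : ∀ p, HasFDerivAt (fun p => ∫ θ in (0:ℝ)..1, g (p, θ))
        (∫ θ in (0:ℝ)..1, g' (p, θ)) p := by
      intro p
      have hK : IsCompact (Metric.closedBall p 1 ×ˢ Set.Icc (0:ℝ) 1) :=
        (isCompact_closedBall p 1).prod isCompact_Icc
      obtain ⟨M, hM⟩ := hK.exists_bound_of_continuousOn hg'c.continuousOn
      apply intervalIntegral.hasFDerivAt_integral_of_dominated_of_fderiv_le
        (s := Metric.closedBall p 1) (bound := fun _ => M)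
        (F := fun p θ => g (p, θ)) (F' := fun p θ => g' (p, θ))
      · exact Metric.closedBall_mem_nhds p one_pos
      · exact Eventually.of_forall fun q =>
          (Continuous.aestronglyMeasurable (by fun_prop))
      · exact Continuous.intervalIntegrable (by fun_prop) _ _
      · exact Continuous.aestronglyMeasurable (by fun_prop)
      · refine Eventually.of_forall fun θ hθ q hq => hM (q, θ) ⟨hq, ?_⟩
        rw [Set.uIoc_of_le zero_le_one] at hθ
        exact ⟨hθ.1.le, hθ.2⟩
      · exact intervalIntegrable_const
      · exact Eventually.of_forall fun θ _ q _ => hd q θ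
    have : ((n + 1 : ℕ) : WithTop ℕ∞) = (n : WithTop ℕ∞) + 1 := by norm_cast
    rw [this, contDiff_succ_iff_fderiv]
    refine ⟨fun p => (key p).differentiableAt, by simp, ?_⟩
    have e : fderiv ℝ (fun p => ∫ θ in (0:ℝ)..1, g (p, θ)) =
        fun p => ∫ θ in (0:ℝ)..1, g' (p, θ) := by
      funext p; exact (key p).fderiv
    rw [e]
    exact ih g' hg'1

lemma SmoothT.prim {f : ℝ → ℝ × ℝ → ℝ} (hf : SmoothT f) :
    SmoothT (fun t x => ∫ s in (0:ℝ)..t, f s x) := by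
  intro n
  have h := contDiff_param (E := ℝ × (ℝ × ℝ)) n (fun q => f (q.1.1 * q.2) q.1.2) (by
    have := (hf n).comp (g := fun p : ℝ × (ℝ × ℝ) => f p.1 p.2)
      (f := fun q : (ℝ × (ℝ × ℝ)) × ℝ => (q.1.1 * q.2, q.1.2)) (by fun_prop)
    exact this)
  have h2 : ContDiff ℝ n (fun p : ℝ × (ℝ × ℝ) => p.1 * ∫ θ in (0:ℝ)..1, f (p.1 * θ) p.2) :=
    contDiff_fst.mul h
  have e : (fun p : ℝ × (ℝ × ℝ) => ∫ s in (0:ℝ)..p.1, f s p.2) =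
      fun p => p.1 * ∫ θ in (0:ℝ)..1, f (p.1 * θ) p.2 := by
    funext p
    have := intervalIntegral.mul_integral_comp_mul_left (f := fun s => f s p.2) (a := 0) (b := 1) p.1
    simp at this
    simp [this]
  rw [e]
  exact h2

lemma pdt_prim {f : ℝ → ℝ × ℝ → ℝ} (hf : SmoothT f) :
    pdt (fun t x => ∫ s in (0:ℝ)..t, f s x) = f := by
  funext t x
  exact ((hf.contDiff_time x).continuous.deriv_integral _ _ _)

lemma sdir_prim {f : ℝ → ℝ × ℝ → ℝ} (hf : SmoothT f) (e : ℝ × ℝ) (t : ℝ) (x : ℝ × ℝ) :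
    sdir e (fun t x => ∫ s in (0:ℝ)..t, f s x) t x = ∫ s in (0:ℝ)..t, sdir e f s x := by
  have h1 : ∀ s, HasDerivAt (fun s => sdir e (fun t x => ∫ s in (0:ℝ)..t, f s x) s x)
      (sdir e f s x) s := by
    intro s
    have := (((hf.prim.sdir e).contDiff_time x).differentiable (by simp) s).hasDerivAt
    have h3 : pdt (sdir e (fun t x => ∫ s in (0:ℝ)..t, f s x)) s x = sdir e f s x := by
      rw [pdt_sdir hf.prim, pdt_prim hf]
    rw [← h3]
    exact this
  rw [intervalIntegral.integral_eq_sub_of_hasDerivAt (fun s _ => h1 s)]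
  · simp [sdir]
  · exact ((hf.sdir e).contDiff_time x).continuous.intervalIntegrable _ _

/-! ### Part 2: integration on the square -/

lemma Oset_subset : Oset ⊆ Set.Icc (0:ℝ) 1 ×ˢ Set.Icc (0:ℝ) 1 :=
  Set.prod_mono Set.Ioo_subset_Icc_self Set.Ioo_subset_Icc_self

lemma measurableSet_Oset : MeasurableSet Oset := measurableSet_Ioo.prod measurableSet_Ioo

lemma isOpen_Oset : IsOpen Oset := isOpen_Ioo.prod isOpen_Ioo

lemma isCompact_sq : IsCompact (Set.Icc (0:ℝ) 1 ×ˢ Set.Icc (0:ℝ) 1) :=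
  isCompact_Icc.prod isCompact_Icc

lemma intO {f : ℝ × ℝ → ℝ} (hf : Continuous f) : IntegrableOn f Oset :=
  (hf.continuousOn.integrableOn_compact isCompact_sq).mono_set Oset_subset

lemma Oset_restrict : (volume.restrict Oset : Measure (ℝ × ℝ)) =
    (volume.restrict (Set.Ioc (0:ℝ) 1)).prod (volume.restrict (Set.Ioc (0:ℝ) 1)) := by
  unfold Oset
  rw [Measure.volume_eq_prod, ← Measure.prod_restrict]
  congr 1 <;> exact Measure.restrict_congr_set Ioo_ae_eq_Ioc

lemma intO_eq_sq (f : ℝ × ℝ → ℝ) :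
    ∫ x in Oset, f x = ∫ x in Set.Icc (0:ℝ) 1 ×ˢ Set.Icc (0:ℝ) 1, f x := by
  have : (volume.restrict Oset : Measure (ℝ × ℝ)) =
      volume.restrict (Set.Icc (0:ℝ) 1 ×ˢ Set.Icc (0:ℝ) 1) := by
    unfold Oset
    rw [Measure.volume_eq_prod, ← Measure.prod_restrict, ← Measure.prod_restrict]
    congr 1 <;> exact Measure.restrict_congr_set Ioo_ae_eq_Icc
  rw [this]

lemma intO_iter {f : ℝ × ℝ → ℝ} (hf : Continuous f) :
    ∫ x in Oset, f x = ∫ a in (0:ℝ)..1, ∫ b in (0:ℝ)..1, f (a, b) := by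
  have h := intO hf
  unfold IntegrableOn at h
  rw [Oset_restrict] at h ⊢
  rw [integral_prod _ h]
  simp only [intervalIntegral.integral_of_le zero_le_one]

lemma intO_iter' {f : ℝ × ℝ → ℝ} (hf : Continuous f) :
    ∫ x in Oset, f x = ∫ b in (0:ℝ)..1, ∫ a in (0:ℝ)..1, f (a, b) := by
  have h := intO hf
  unfold IntegrableOn at h
  rw [Oset_restrict] at h ⊢
  rw [integral_prod_symm _ h]
  simp only [intervalIntegral.integral_of_le zero_le_one]

lemma intO_mono {f g : ℝ × ℝ → ℝ} (hf : Continuous f) (hg : Continuous g)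
    (h : ∀ x ∈ Oset, f x ≤ g x) : ∫ x in Oset, f x ≤ ∫ x in Oset, g x :=
  setIntegral_mono_on (intO hf) (intO hg) measurableSet_Oset h

lemma intO_nonneg {f : ℝ × ℝ → ℝ} (h : ∀ x ∈ Oset, 0 ≤ f x) : 0 ≤ ∫ x in Oset, f x :=
  setIntegral_nonneg measurableSet_Oset h

lemma intO_add {f g : ℝ × ℝ → ℝ} (hf : Continuous f) (hg : Continuous g) :
    ∫ x in Oset, (f x + g x) = (∫ x in Oset, f x) + ∫ x in Oset, g x :=
  integral_add (intO hf) (intO hg)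

lemma intO_sub {f g : ℝ × ℝ → ℝ} (hf : Continuous f) (hg : Continuous g) :
    ∫ x in Oset, (f x - g x) = (∫ x in Oset, f x) - ∫ x in Oset, g x :=
  integral_sub (intO hf) (intO hg)

lemma intO_const (c : ℝ) : ∫ _x in Oset, c = c := by
  rw [intO_iter continuous_const]; simp

lemma hasDerivAt_snd {F : ℝ × ℝ → ℝ} (hF : ContDiff ℝ ∞ F) (a b : ℝ) :
    HasDerivAt (fun b => F (a, b)) (fderiv ℝ F (a, b) (0, 1)) b := by
  have h1 : HasFDerivAt F (fderiv ℝ F (a, b)) (a, b) :=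
    (hF.differentiable (by simp) _).hasFDerivAt
  exact h1.comp_hasDerivAt b ((hasDerivAt_const b a).prodMk (hasDerivAt_id b))

lemma hasDerivAt_fst {F : ℝ × ℝ → ℝ} (hF : ContDiff ℝ ∞ F) (a b : ℝ) :
    HasDerivAt (fun a => F (a, b)) (fderiv ℝ F (a, b) (1, 0)) a := by
  have h1 : HasFDerivAt F (fderiv ℝ F (a, b)) (a, b) :=
    (hF.differentiable (by simp) _).hasFDerivAt
  exact h1.comp_hasDerivAt a ((hasDerivAt_id a).prodMk (hasDerivAt_const a b))

lemma int_d2_zero {F : ℝ × ℝ → ℝ} (hF : ContDiff ℝ ∞ F) (h0 : ∀ a, F (a, 0) = 0)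
    (h1 : ∀ a, F (a, 1) = 0) : ∫ x in Oset, fderiv ℝ F x (0, 1) = 0 := by
  have hc := (contDiff_dir hF (0, 1)).continuous
  rw [intO_iter hc]
  have : ∀ a : ℝ, ∫ b in (0:ℝ)..1, fderiv ℝ F (a, b) (0, 1) = 0 := by
    intro a
    rw [intervalIntegral.integral_eq_sub_of_hasDerivAt (fun b _ => hasDerivAt_snd hF a b), h0, h1,
      sub_zero]
    exact (hc.comp (by fun_prop : Continuous fun b : ℝ => (a, b))).intervalIntegrable _ _
  simp [this]

lemma int_d1_zero {F : ℝ × ℝ → ℝ} (hF : ContDiff ℝ ∞ F) (h0 : Per F) :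
    ∫ x in Oset, fderiv ℝ F x (1, 0) = 0 := by
  have hc := (contDiff_dir hF (1, 0)).continuous
  rw [intO_iter' hc]
  have : ∀ b : ℝ, ∫ a in (0:ℝ)..1, fderiv ℝ F (a, b) (1, 0) = 0 := by
    intro b
    rw [intervalIntegral.integral_eq_sub_of_hasDerivAt (fun a _ => hasDerivAt_fst hF a b)]
    · have := h0 (0, b)
      simp at this
      rw [this, sub_self]
    · exact (hc.comp (by fun_prop : Continuous fun a : ℝ => (a, b))).intervalIntegrable _ _
  simp [this]

/-- one-dimensional embedding -/
lemma sup1d {g g' : ℝ → ℝ} (hg : ∀ y, HasDerivAt g (g' y) y) (hg' : Continuous g')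
    {y : ℝ} (hy : y ∈ Set.Icc (0:ℝ) 1) :
    g y ^ 2 ≤ 2 * ∫ z in (0:ℝ)..1, (g z ^ 2 + g' z ^ 2) := by
  have hgc : Continuous g := continuous_iff_continuousAt.2 fun y => (hg y).continuousAt
  set A := ∫ z in (0:ℝ)..1, (g z ^ 2 + g' z ^ 2) with hA
  have hci : Continuous fun z => g z ^ 2 + g' z ^ 2 := by fun_prop
  have key : ∀ z ∈ Set.Icc (0:ℝ) 1, g y ^ 2 - g z ^ 2 ≤ A := by
    intro z hz
    have h1 : ∫ s in z..y, 2 * g s * g' s = g y ^ 2 - g z ^ 2 := by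
      rw [intervalIntegral.integral_eq_sub_of_hasDerivAt (f := fun s => g s ^ 2)]
      · intro s _
        have := (hg s).fun_pow 2
        norm_num at this
        exact this
      · exact Continuous.intervalIntegrable (by fun_prop) _ _
    rw [← h1]
    calc ∫ s in z..y, 2 * g s * g' s ≤ |∫ s in z..y, 2 * g s * g' s| := le_abs_self _
      _ ≤ |(∫ s in z..y, ‖2 * g s * g' s‖)| := by
          simpa only [Real.norm_eq_abs] using intervalIntegral.norm_integral_le_abs_integral_norm
            (f := fun s => 2 * g s * g' s) (a := z) (b := y) (μ := volume)
      _ ≤ |(∫ s in (0:ℝ)..1, ‖2 * g s * g' s‖)| := by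
          apply intervalIntegral.abs_integral_mono_interval
          · rw [Set.uIoc_of_le zero_le_one, Set.uIoc]
            exact Set.Ioc_subset_Ioc (le_min hz.1 hy.1) (max_le hz.2 hy.2)
          · exact Eventually.of_forall fun s => norm_nonneg _
          · exact Continuous.intervalIntegrable (by fun_prop) _ _
      _ = ∫ s in (0:ℝ)..1, ‖2 * g s * g' s‖ :=
          abs_of_nonneg (intervalIntegral.integral_nonneg zero_le_one fun s _ => norm_nonneg _)
      _ ≤ A := by
          apply intervalIntegral.integral_mono_on zero_le_one
          · exact Continuous.intervalIntegrable (by fun_prop) _ _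
          · exact hci.intervalIntegrable _ _
          · intro s _
            rw [Real.norm_eq_abs, abs_le]
            constructor <;> nlinarith [sq_nonneg (g s + g' s), sq_nonneg (g s - g' s)]
  have h2 : ∫ _z in (0:ℝ)..1, (g y ^ 2) ≤ ∫ z in (0:ℝ)..1, (g z ^ 2 + A) := by
    apply intervalIntegral.integral_mono_on zero_le_one
    · exact intervalIntegrable_const
    · exact Continuous.intervalIntegrable (by fun_prop) _ _
    · intro z hz; linarith [key z hz]
  rw [intervalIntegral.integral_add (Continuous.intervalIntegrable (by fun_prop) _ _)
    intervalIntegrable_const] at h2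
  simp only [intervalIntegral.integral_const, sub_zero, one_smul] at h2
  have h3 : ∫ z in (0:ℝ)..1, g z ^ 2 ≤ A := by
    apply intervalIntegral.integral_mono_on zero_le_one
    · exact Continuous.intervalIntegrable (by fun_prop) _ _
    · exact hci.intervalIntegrable _ _
    · intro z _; nlinarith [sq_nonneg (g' z)]
  linarith

/-- anisotropic two-dimensional embedding -/
lemma sup2d {f : ℝ × ℝ → ℝ} (hf : ContDiff ℝ ∞ f) {x : ℝ × ℝ} (hx : x ∈ Oset) :
    f x ^ 2 ≤ 4 * ∫ y in Oset, (f y ^ 2 + (pd1 f y) ^ 2 + ((pd2 f y) ^ 2 + (pd1 (pd2 f) y) ^ 2)) := by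
  have h1 : ContDiff ℝ ∞ (pd1 f) := contDiff_dir hf _
  have h2 : ContDiff ℝ ∞ (pd2 f) := contDiff_dir hf _
  have h12 : ContDiff ℝ ∞ (pd1 (pd2 f)) := contDiff_dir h2 _
  have c0 := hf.continuous
  have c1 := h1.continuous
  have c2 := h2.continuous
  have c12 := h12.continuous
  obtain ⟨a, b⟩ := x
  have ha : a ∈ Set.Icc (0:ℝ) 1 := Set.Ioo_subset_Icc_self hx.1
  have hb : b ∈ Set.Icc (0:ℝ) 1 := Set.Ioo_subset_Icc_self hx.2
  have e1 := sup1d (g := fun b => f (a, b)) (g' := fun b => pd2 f (a, b))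
    (fun y => hasDerivAt_snd hf a y) (by fun_prop) hb
  have e2 : ∀ z, f (a, z) ^ 2 + pd2 f (a, z) ^ 2 ≤ 2 * ∫ w in (0:ℝ)..1,
      (f (w, z) ^ 2 + (pd1 f (w, z)) ^ 2 + ((pd2 f (w, z)) ^ 2 + (pd1 (pd2 f) (w, z)) ^ 2)) := by
    intro z
    have e3 := sup1d (g := fun a => f (a, z)) (g' := fun b => pd1 f (b, z))
      (fun y => hasDerivAt_fst hf y z) (by fun_prop) ha
    have e4 := sup1d (g := fun a => pd2 f (a, z)) (g' := fun b => pd1 (pd2 f) (b, z))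
      (fun y => hasDerivAt_fst h2 y z) (by fun_prop) ha
    rw [intervalIntegral.integral_add (Continuous.intervalIntegrable (by fun_prop) _ _)
      (Continuous.intervalIntegrable (by fun_prop) _ _)]
    linarith
  have cI : Continuous fun z => ∫ w in (0:ℝ)..1,
      (f (w, z) ^ 2 + (pd1 f (w, z)) ^ 2 + ((pd2 f (w, z)) ^ 2 + (pd1 (pd2 f) (w, z)) ^ 2)) := by
    apply intervalIntegral.continuous_parametric_intervalIntegral_of_continuous'
      (f := fun z w =>
      (f (w, z) ^ 2 + (pd1 f (w, z)) ^ 2 + ((pd2 f (w, z)) ^ 2 + (pd1 (pd2 f) (w, z)) ^ 2)))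
    simp only [Function.uncurry_def]
    fun_prop
  rw [intO_iter' (by fun_prop)]
  have e5 : ∫ z in (0:ℝ)..1, (f (a, z) ^ 2 + pd2 f (a, z) ^ 2) ≤
      ∫ z in (0:ℝ)..1, 2 * ∫ w in (0:ℝ)..1,
      (f (w, z) ^ 2 + (pd1 f (w, z)) ^ 2 + ((pd2 f (w, z)) ^ 2 + (pd1 (pd2 f) (w, z)) ^ 2)) := by
    apply intervalIntegral.integral_mono_on zero_le_one
    · exact Continuous.intervalIntegrable (by fun_prop) _ _
    · exact (cI.const_mul 2).intervalIntegrable _ _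
    · intro z _; exact e2 z
  rw [intervalIntegral.integral_const_mul] at e5
  linarith

/-- the polynomial weight -/
def qw (x : ℝ × ℝ) : ℝ := x.2 * (1 - x.2)

lemma qw_nonneg {x : ℝ × ℝ} (hx : x ∈ Oset) : 0 ≤ qw x :=
  mul_nonneg hx.2.1.le (by linarith [hx.2.2])

lemma continuous_qw : Continuous qw := by unfold qw; fun_prop

/-- weighted Hardy inequality -/
lemma hardy {g : ℝ × ℝ → ℝ} (hg : ContDiff ℝ ∞ g) (m : ℕ) :
    ∫ x in Oset, qw x ^ m * g x ^ 2 ≤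
      (8 * m + 12) * (∫ x in Oset, qw x ^ (m + 1) * g x ^ 2)
        + 4 * ∫ x in Oset, qw x ^ (m + 2) * pd2 g x ^ 2 := by
  have cg := hg.continuous
  have cg2 : Continuous (pd2 g) := (contDiff_dir hg (0, 1)).continuous
  have cq := continuous_qw
  set F : ℝ × ℝ → ℝ := fun x => qw x ^ (m + 1) * (1 - 2 * x.2) * g x ^ 2 with hFdef
  have hF : ContDiff ℝ ∞ F := by
    rw [hFdef]; unfold qw; fun_prop
  have hz := int_d2_zero hF (by intro a; simp [F, qw]) (by intro a; simp [F, qw])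
  have hder : ∀ x, fderiv ℝ F x (0, 1) =
      ((m + 1) * qw x ^ m - (4 * m + 6) * qw x ^ (m + 1)) * g x ^ 2
        + 2 * qw x ^ (m + 1) * (1 - 2 * x.2) * g x * pd2 g x := by
    rintro ⟨a, b⟩
    have h1 := hasDerivAt_snd hF a b
    have hq : HasDerivAt (fun b : ℝ => b * (1 - b)) (1 - 2 * b) b := by
      have := (hasDerivAt_id b).mul ((hasDerivAt_id b).const_sub 1)
      simp only [id_eq] at this
      have e : (1 - 2 * b : ℝ) = 1 * (1 - b) + b * -1 := by ring
      rw [e]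
      exact this
    have h3 : HasDerivAt (fun b : ℝ => 1 - 2 * b) (-2) b := by
      have := ((hasDerivAt_id b).const_mul 2).const_sub 1
      simpa using this
    have h4 := ((hq.pow (m + 1)).mul h3).mul ((hasDerivAt_snd hg a b).pow 2)
    have h5 := h1.unique h4
    rw [h5]
    simp only [qw, pd2]
    push_cast
    simp
    ring
  have hpt : ∀ x ∈ Oset, (1/2) * (qw x ^ m * g x ^ 2) - (4 * m + 6) * (qw x ^ (m + 1) * g x ^ 2)
      - 2 * (qw x ^ (m + 2) * pd2 g x ^ 2) ≤ fderiv ℝ F x (0, 1) := by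
    intro x hx
    rw [hder]
    have hq := qw_nonneg hx
    have hqm : 0 ≤ qw x ^ m := pow_nonneg hq m
    have hb : (1 - 2 * x.2) ^ 2 ≤ 1 := by nlinarith [hx.2.1, hx.2.2]
    have e1 : qw x ^ (m + 1) = qw x ^ m * qw x := pow_succ _ _
    have e2 : qw x ^ (m + 2) = qw x ^ m * qw x ^ 2 := pow_add _ _ _
    rw [e1, e2]
    have hm : (0:ℝ) ≤ m := Nat.cast_nonneg m
    have k : 0 ≤ (1/2) * g x ^ 2 + 2 * (qw x * (1 - 2 * x.2)) * g x * pd2 g x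
        + 2 * (qw x * pd2 g x) ^ 2 := by
      have : 0 ≤ 2 * (qw x * pd2 g x) ^ 2 * (1 - (1 - 2 * x.2) ^ 2) :=
        mul_nonneg (by positivity) (by linarith)
      nlinarith [sq_nonneg (g x + 2 * (qw x * (1 - 2 * x.2)) * pd2 g x)]
    have k2 := mul_nonneg hqm k
    have k3 : 0 ≤ qw x ^ m * (m * g x ^ 2) := by positivity
    nlinarith
  have hI := intO_mono (by fun_prop) (contDiff_dir hF (0, 1)).continuous hpt
  rw [hz, intO_sub (by fun_prop) (by fun_prop), intO_sub (by fun_prop) (by fun_prop),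
    integral_const_mul, integral_const_mul, integral_const_mul] at hI
  linarith

lemma cont_intO {f : ℝ → ℝ × ℝ → ℝ} (hf : Continuous fun p : ℝ × (ℝ × ℝ) => f p.1 p.2) :
    Continuous fun s => ∫ x in Oset, f s x := by
  simp only [intO_eq_sq]
  exact continuous_parametric_integral_of_continuous (f := f) hf isCompact_sq

lemma time_ftc {f : ℝ → ℝ × ℝ → ℝ} (hf : SmoothT f) {t : ℝ} (ht : 0 ≤ t) :
    ∫ x in Oset, f t x = (∫ x in Oset, f 0 x) + ∫ s in (0:ℝ)..t, ∫ x in Oset, pdt f s x := by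
  have h1 : ∀ x, f t x - f 0 x = ∫ s in (0:ℝ)..t, pdt f s x := by
    intro x
    rw [intervalIntegral.integral_eq_sub_of_hasDerivAt (f := fun s => f s x)]
    · intro s _
      exact ((hf.contDiff_time x).differentiable (by simp) s).hasDerivAt
    · exact (hf.pdt.contDiff_time x).continuous.intervalIntegrable _ _
  have hc := hf.pdt.continuous
  have h2 : ∫ s in (0:ℝ)..t, ∫ x in Oset, pdt f s x = ∫ x in Oset, ∫ s in (0:ℝ)..t, pdt f s x := by
    simp only [intervalIntegral.integral_of_le ht]
    apply integral_integral_swap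
    have : IntegrableOn (Function.uncurry fun s x => pdt f s x)
        (Set.Icc 0 t ×ˢ (Set.Icc (0:ℝ) 1 ×ˢ Set.Icc (0:ℝ) 1)) :=
      hc.continuousOn.integrableOn_compact (isCompact_Icc.prod isCompact_sq)
    have h3 := this.mono_set (Set.prod_mono Set.Ioc_subset_Icc_self Oset_subset)
    unfold IntegrableOn at h3
    rwa [Measure.volume_eq_prod, ← Measure.prod_restrict] at h3
  rw [h2, ← integral_congr_ae (Eventually.of_forall h1),
    integral_sub (intO (hf.smoothFn t).continuous') (intO (hf.smoothFn 0).continuous')]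
  ring

/-! ### Part 3: energy pieces and sup bounds -/

lemma SmoothFn.pd1 {G : Type*} [NormedAddCommGroup G] [NormedSpace ℝ G]
    {f : ℝ × ℝ → G} (hf : SmoothFn f) : SmoothFn (pd1 f) :=
  smoothFn_iff.2 (contDiff_dir (smoothFn_iff.1 hf) _)

lemma SmoothFn.pd2 {G : Type*} [NormedAddCommGroup G] [NormedSpace ℝ G]
    {f : ℝ × ℝ → G} (hf : SmoothFn f) : SmoothFn (pd2 f) :=
  smoothFn_iff.2 (contDiff_dir (smoothFn_iff.1 hf) _)

lemma SmoothFn.pd1_iter {G : Type*} [NormedAddCommGroup G] [NormedSpace ℝ G]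
    {f : ℝ × ℝ → G} (hf : SmoothFn f) (n : ℕ) : SmoothFn (_root_.pd1^[n] f) := by
  induction n with
  | zero => exact hf
  | succ n ih => rw [Function.iterate_succ_apply']; exact ih.pd1

lemma SmoothFn.pd2_iter {G : Type*} [NormedAddCommGroup G] [NormedSpace ℝ G]
    {f : ℝ × ℝ → G} (hf : SmoothFn f) (n : ℕ) : SmoothFn (_root_.pd2^[n] f) := by
  induction n with
  | zero => exact hf
  | succ n ih => rw [Function.iterate_succ_apply']; exact ih.pd2

lemma pd2_pd1 {G : Type*} [NormedAddCommGroup G] [NormedSpace ℝ G]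
    {f : ℝ × ℝ → G} (hf : SmoothFn f) : pd2 (pd1 f) = pd1 (pd2 f) := by
  funext x
  exact dir_comm (smoothFn_iff.1 hf) _ _ _

lemma pd2_pd1_iter {G : Type*} [NormedAddCommGroup G] [NormedSpace ℝ G]
    {f : ℝ × ℝ → G} (hf : SmoothFn f) (n : ℕ) : pd2 (pd1^[n] f) = pd1^[n] (pd2 f) := by
  induction n with
  | zero => rfl
  | succ n ih =>
    rw [Function.iterate_succ_apply', Function.iterate_succ_apply', pd2_pd1 (hf.pd1_iter n), ih]

lemma pd1_pick {f : ℝ × ℝ → ℝ × ℝ} (hf : SmoothFn f) (i : Fin 2) :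
    pd1 (fun x => pick i (f x)) = fun x => pick i (pd1 f x) := by
  funext x
  exact pick_fderiv ((smoothFn_iff.1 hf).differentiable (by simp) x) i _

lemma pd2_pick {f : ℝ × ℝ → ℝ × ℝ} (hf : SmoothFn f) (i : Fin 2) :
    pd2 (fun x => pick i (f x)) = fun x => pick i (pd2 f x) := by
  funext x
  exact pick_fderiv ((smoothFn_iff.1 hf).differentiable (by simp) x) i _

lemma pd1_iter_pick {f : ℝ × ℝ → ℝ × ℝ} (hf : SmoothFn f) (i : Fin 2) (n : ℕ) :
    pd1^[n] (fun x => pick i (f x)) = fun x => pick i ((pd1^[n] f) x) := by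
  induction n with
  | zero => rfl
  | succ n ih =>
    rw [Function.iterate_succ_apply', Function.iterate_succ_apply', ih, pd1_pick (hf.pd1_iter n)]

lemma pd2_iter_pick {f : ℝ × ℝ → ℝ × ℝ} (hf : SmoothFn f) (i : Fin 2) (n : ℕ) :
    pd2^[n] (fun x => pick i (f x)) = fun x => pick i ((pd2^[n] f) x) := by
  induction n with
  | zero => rfl
  | succ n ih =>
    rw [Function.iterate_succ_apply', Function.iterate_succ_apply', ih, pd2_pick (hf.pd2_iter n)]

lemma SmoothFn.pick {f : ℝ × ℝ → ℝ × ℝ} (hf : SmoothFn f) (i : Fin 2) :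
    SmoothFn (fun x => pick i (f x)) := by
  rw [smoothFn_iff] at *
  have := (pickL i).contDiff (n := ∞) |>.comp hf
  have e : (fun x => _root_.pick i (f x)) = (pickL i) ∘ f := by
    funext p; simp [pickL_apply]
  rw [e]
  exact this

lemma density_nonneg {C₁ C₂ : ℝ} (hC₁ : 0 < C₁) {ρ : ℝ × ℝ → ℝ} (h : IsDensity C₁ C₂ ρ)
    {x : ℝ × ℝ} (hx : x ∈ Oset) : 0 ≤ ρ x := by
  have h1 := (h.2.2.2 x hx).1
  have h2 : 0 ≤ distG x := le_min hx.2.1.le (by linarith [hx.2.2])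
  have := mul_nonneg hC₁.le h2
  linarith

lemma density_le {C₁ C₂ : ℝ} (hC₂ : 0 < C₂) {ρ : ℝ × ℝ → ℝ} (h : IsDensity C₁ C₂ ρ)
    {x : ℝ × ℝ} (hx : x ∈ Oset) : ρ x ≤ C₂ := by
  have h1 := (h.2.2.2 x hx).2
  have h2 : distG x ≤ 1 := (min_le_left _ _).trans hx.2.2.le
  nlinarith

lemma qw_le {C₁ C₂ : ℝ} (hC₁ : 0 < C₁) {ρ : ℝ × ℝ → ℝ} (h : IsDensity C₁ C₂ ρ)
    {x : ℝ × ℝ} (hx : x ∈ Oset) : qw x ≤ (1 + 1 / C₁) * ρ x := by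
  have h1 := (h.2.2.2 x hx).1
  have h0 := density_nonneg hC₁ h hx
  have h2 : qw x ≤ distG x := by
    have a := hx.2.1
    have b := hx.2.2
    unfold qw distG
    apply le_min <;> nlinarith
  have h3 : distG x ≤ 1 / C₁ * ρ x := by
    rw [one_div, ← div_eq_inv_mul, le_div_iff₀ hC₁]; linarith
  linarith

lemma gradSq_nonneg {G : Type*} [NormedAddCommGroup G] [NormedSpace ℝ G] (f : ℝ × ℝ → G)
    (x : ℝ × ℝ) : 0 ≤ gradSq f x := by unfold gradSq; positivity

section energy
variable {ρ : ℝ × ℝ → ℝ} (hρ : ∀ x ∈ Oset, 0 ≤ ρ x) (v : ℝ → ℝ × ℝ → ℝ × ℝ) (t : ℝ)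

lemma en_a_nonneg (hρ : ∀ x ∈ Oset, 0 ≤ ρ x) (l₀ : ℕ) :
    0 ≤ ∫ x in Oset, ρ x * ‖(pdt^[l₀] v) t x‖ ^ 2 :=
  intO_nonneg fun x hx => mul_nonneg (hρ x hx) (by positivity)

lemma en_b_nonneg (hρ : ∀ x ∈ Oset, 0 ≤ ρ x) (l₀ l₁ : ℕ) :
    0 ≤ ∫ x in Oset, ρ x *
          (gradSq (pd1^[l₁] ((pdt^[l₀] v) t)) x + gradSq (pd1^[l₁ + 1] ((pdt^[l₀] v) t)) x) :=
  intO_nonneg fun x hx => mul_nonneg (hρ x hx) (add_nonneg (gradSq_nonneg _ _) (gradSq_nonneg _ _))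

lemma en_c_nonneg (hρ : ∀ x ∈ Oset, 0 ≤ ρ x) (l₀ l₁ l₂ : ℕ) :
    0 ≤ ∫ x in Oset, ρ x ^ l₂ * ‖(pd1^[l₁] (pd2^[l₂] ((pdt^[l₀] v) t))) x‖ ^ 2 :=
  intO_nonneg fun x hx => mul_nonneg (pow_nonneg (hρ x hx) _) (by positivity)

lemma en_a_le (hρ : ∀ x ∈ Oset, 0 ≤ ρ x) {l₀ : ℕ} (h : l₀ < 5) :
    ∫ x in Oset, ρ x * ‖(pdt^[l₀] v) t x‖ ^ 2 ≤ energy ρ v t := by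
  unfold energy
  have h1 := Finset.single_le_sum (f := fun l₀ => ∫ x in Oset, ρ x * ‖(pdt^[l₀] v) t x‖ ^ 2)
    (fun i _ => en_a_nonneg v t hρ i) (Finset.mem_range.2 h)
  have h2 := Finset.sum_nonneg (fun i (_ : i ∈ Finset.range 4) =>
    Finset.sum_nonneg (fun j (_ : j ∈ Finset.range (7 - 2 * i)) => en_b_nonneg v t hρ i j))
  have h3 := Finset.sum_nonneg (fun i (_ : i ∈ Finset.range 4) =>
    Finset.sum_nonneg (fun j (_ : j ∈ Finset.range (7 - 2 * i)) =>
      Finset.sum_nonneg (fun k (_ : k ∈ Finset.Icc 2 (8 - 2 * i - j)) => en_c_nonneg v t hρ i j k)))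
  linarith

lemma energy_nonneg (hρ : ∀ x ∈ Oset, 0 ≤ ρ x) : 0 ≤ energy ρ v t :=
  (en_a_nonneg v t hρ 0).trans (en_a_le v t hρ (by norm_num))

lemma en_b_le (hρ : ∀ x ∈ Oset, 0 ≤ ρ x) {l₀ l₁ : ℕ} (h : l₀ < 4) (h' : l₁ < 7 - 2 * l₀) :
    ∫ x in Oset, ρ x *
      (gradSq (pd1^[l₁] ((pdt^[l₀] v) t)) x + gradSq (pd1^[l₁ + 1] ((pdt^[l₀] v) t)) x)
      ≤ energy ρ v t := by
  unfold energy
  have h1 := Finset.sum_nonneg (fun i (_ : i ∈ Finset.range 5) => en_a_nonneg v t hρ i)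
  have h2 := Finset.single_le_sum (f := fun l₀ => ∑ l₁ ∈ Finset.range (7 - 2 * l₀),
        ∫ x in Oset, ρ x *
          (gradSq (pd1^[l₁] ((pdt^[l₀] v) t)) x + gradSq (pd1^[l₁ + 1] ((pdt^[l₀] v) t)) x))
    (fun i _ => Finset.sum_nonneg (fun j _ => en_b_nonneg v t hρ i j)) (Finset.mem_range.2 h)
  have h2' := Finset.single_le_sum (f := fun l₁ => 
        ∫ x in Oset, ρ x *
          (gradSq (pd1^[l₁] ((pdt^[l₀] v) t)) x + gradSq (pd1^[l₁ + 1] ((pdt^[l₀] v) t)) x))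
    (fun j _ => en_b_nonneg v t hρ l₀ j) (Finset.mem_range.2 h')
  have h3 := Finset.sum_nonneg (fun i (_ : i ∈ Finset.range 4) =>
    Finset.sum_nonneg (fun j (_ : j ∈ Finset.range (7 - 2 * i)) =>
      Finset.sum_nonneg (fun k (_ : k ∈ Finset.Icc 2 (8 - 2 * i - j)) => en_c_nonneg v t hρ i j k)))
  linarith

lemma en_c_le (hρ : ∀ x ∈ Oset, 0 ≤ ρ x) {l₀ l₁ l₂ : ℕ} (h : l₀ < 4) (h' : l₁ < 7 - 2 * l₀)
    (h2 : 2 ≤ l₂) (h3 : l₂ ≤ 8 - 2 * l₀ - l₁) :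
    ∫ x in Oset, ρ x ^ l₂ * ‖(pd1^[l₁] (pd2^[l₂] ((pdt^[l₀] v) t))) x‖ ^ 2 ≤ energy ρ v t := by
  unfold energy
  have k1 := Finset.sum_nonneg (fun i (_ : i ∈ Finset.range 5) => en_a_nonneg v t hρ i)
  have k2 := Finset.sum_nonneg (fun i (_ : i ∈ Finset.range 4) =>
    Finset.sum_nonneg (fun j (_ : j ∈ Finset.range (7 - 2 * i)) => en_b_nonneg v t hρ i j))
  have k3 := Finset.single_le_sum (f := fun l₀ => ∑ l₁ ∈ Finset.range (7 - 2 * l₀),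
        ∑ l₂ ∈ Finset.Icc 2 (8 - 2 * l₀ - l₁),
          ∫ x in Oset, ρ x ^ l₂ * ‖(pd1^[l₁] (pd2^[l₂] ((pdt^[l₀] v) t))) x‖ ^ 2)
    (fun i _ => Finset.sum_nonneg (fun j _ => Finset.sum_nonneg
      (fun k _ => en_c_nonneg v t hρ i j k))) (Finset.mem_range.2 h)
  have k4 := Finset.single_le_sum (f := fun l₁ => 
        ∑ l₂ ∈ Finset.Icc 2 (8 - 2 * l₀ - l₁),
          ∫ x in Oset, ρ x ^ l₂ * ‖(pd1^[l₁] (pd2^[l₂] ((pdt^[l₀] v) t))) x‖ ^ 2)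
    (fun j _ => Finset.sum_nonneg
      (fun k _ => en_c_nonneg v t hρ l₀ j k)) (Finset.mem_range.2 h')
  have k5 := Finset.single_le_sum (f := fun l₂ => 
          ∫ x in Oset, ρ x ^ l₂ * ‖(pd1^[l₁] (pd2^[l₂] ((pdt^[l₀] v) t))) x‖ ^ 2)
    (fun k _ => en_c_nonneg v t hρ l₀ l₁ k) (Finset.mem_Icc.2 ⟨h2, h3⟩)
  linarith

end energy

/-- weighted embedding: sup bounds for the gradient of a scalar function -/
lemma grad_sup {c E : ℝ} (hc : 1 ≤ c) {ρ w : ℝ × ℝ → ℝ} (hρc : Continuous ρ)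
    (hρ : ∀ x ∈ Oset, 0 ≤ ρ x)
    (hq : ∀ x ∈ Oset, qw x ≤ c * ρ x) (hw : SmoothFn w)
    (h1 : ∀ l ≤ 2, ∫ x in Oset, ρ x * (pd1^[l + 1] w) x ^ 2 ≤ E)
    (h2 : ∀ l ≤ 2, ∫ x in Oset, ρ x * (pd1^[l] (pd2 w)) x ^ 2 ≤ E)
    (h3 : ∀ l ≤ 2, ∀ k, 2 ≤ k → k ≤ 4 →
      ∫ x in Oset, ρ x ^ k * (pd1^[l] (pd2^[k] w)) x ^ 2 ≤ E) :
    ∀ x ∈ Oset, pd1 w x ^ 2 ≤ 3456 * c ^ 4 * E ∧ pd2 w x ^ 2 ≤ 3456 * c ^ 4 * E := by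
  have hE : 0 ≤ E := le_trans (intO_nonneg fun x hx => mul_nonneg (hρ x hx) (sq_nonneg _))
    (h1 0 (by norm_num))
  set A := c ^ 4 * E with hA
  have hA0 : 0 ≤ A := by positivity
  set g : ℕ → ℕ → ℝ × ℝ → ℝ := fun l k => pd1^[l] (pd2^[k] w) with hg
  have gs : ∀ l k, SmoothFn (g l k) := fun l k => (hw.pd2_iter k).pd1_iter l
  have gc : ∀ l k, Continuous (g l k) := fun l k => (gs l k).continuous'
  have gd : ∀ l k, ContDiff ℝ ∞ (g l k) := fun l k => smoothFn_iff.1 (gs l k)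
  have g1 : ∀ l k, pd1 (g l k) = g (l + 1) k := by
    intro l k; simp only [hg]; rw [Function.iterate_succ_apply']
  have g2 : ∀ l k, pd2 (g l k) = g l (k + 1) := by
    intro l k; simp only [hg]; rw [pd2_pd1_iter (hw.pd2_iter k), Function.iterate_succ_apply']
  have cq := continuous_qw
  have conv : ∀ k ≤ 4, ∀ f : ℝ × ℝ → ℝ, Continuous f → ∫ x in Oset, ρ x ^ k * f x ^ 2 ≤ E →
      ∫ x in Oset, qw x ^ k * f x ^ 2 ≤ A := by
    intro k hk f hf hfE
    calc ∫ x in Oset, qw x ^ k * f x ^ 2 ≤ ∫ x in Oset, c ^ k * (ρ x ^ k * f x ^ 2) := by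
          apply intO_mono (by fun_prop) (by fun_prop)
          intro x hx
          have : qw x ^ k ≤ (c * ρ x) ^ k := pow_le_pow_left₀ (qw_nonneg hx) (hq x hx) k
          rw [mul_pow] at this
          nlinarith [sq_nonneg (f x)]
      _ = c ^ k * ∫ x in Oset, (ρ x ^ k * f x ^ 2) := integral_const_mul _ _
      _ ≤ c ^ k * E := by gcongr
      _ ≤ c ^ 4 * E := by gcongr
  have b1 : ∀ l ≤ 2, ∫ x in Oset, qw x ^ 1 * g (l + 1) 0 x ^ 2 ≤ A := fun l hl =>
    conv 1 (by norm_num) _ (gc _ _) (by simpa [hg] using h1 l hl)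
  have b2 : ∀ l ≤ 2, ∫ x in Oset, qw x ^ 1 * g l 1 x ^ 2 ≤ A := fun l hl =>
    conv 1 (by norm_num) _ (gc _ _) (by simpa [hg] using h2 l hl)
  have b3 : ∀ l ≤ 2, ∀ k, 2 ≤ k → k ≤ 4 → ∫ x in Oset, qw x ^ k * g l k x ^ 2 ≤ A :=
    fun l hl k hk hk' => conv k hk' _ (gc _ _) (h3 l hl k hk hk')
  have q2 : ∀ l ≤ 2, ∫ x in Oset, qw x ^ 2 * g l 1 x ^ 2 ≤ A := by
    intro l hl
    refine le_trans ?_ (b2 l hl)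
    have := gc l 1
    apply intO_mono (by fun_prop) (by fun_prop)
    intro x hx
    have h0 := qw_nonneg hx
    have hle : qw x ≤ 1 := by
      have a := hx.2.1
      have b := hx.2.2
      unfold qw; nlinarith
    have : qw x ^ 2 ≤ qw x ^ 1 := by nlinarith
    exact mul_le_mul_of_nonneg_right this (sq_nonneg _)
  have H : ∀ l k m : ℕ, ∫ x in Oset, qw x ^ m * g l k x ^ 2 ≤
      (8 * m + 12) * (∫ x in Oset, qw x ^ (m + 1) * g l k x ^ 2)
        + 4 * ∫ x in Oset, qw x ^ (m + 2) * g l (k + 1) x ^ 2 := by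
    intro l k m
    have := hardy (gd l k) m
    rwa [g2] at this
  have c3 : ∀ l ≤ 2, ∫ x in Oset, qw x ^ 2 * g l 3 x ^ 2 ≤ 32 * A := by
    intro l hl
    have := H l 3 2
    have e1 := b3 l hl 3 (by norm_num) (by norm_num)
    have e2 := b3 l hl 4 (by norm_num) (by norm_num)
    norm_num at this
    linarith
  have c2 : ∀ l ≤ 2, ∫ x in Oset, qw x ^ 1 * g l 2 x ^ 2 ≤ 24 * A := by
    intro l hl
    have := H l 2 1
    have e1 := b3 l hl 2 (by norm_num) (by norm_num)
    have e2 := b3 l hl 3 (by norm_num) (by norm_num)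
    norm_num at this ⊢
    linarith
  have d2 : ∀ l ≤ 2, ∫ x in Oset, g l 2 x ^ 2 ≤ 416 * A := by
    intro l hl
    have := H l 2 0
    have e1 := c2 l hl
    have e2 := c3 l hl
    norm_num at this e1
    linarith
  have d1 : ∀ l ≤ 2, ∫ x in Oset, g l 1 x ^ 2 ≤ 16 * A := by
    intro l hl
    have := H l 1 0
    have e1 := b2 l hl
    have e2 := b3 l hl 2 (by norm_num) (by norm_num)
    norm_num at this e1
    linarith
  have d0 : ∀ l ≤ 1, ∫ x in Oset, g (l + 1) 0 x ^ 2 ≤ 16 * A := by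
    intro l hl
    have := H (l + 1) 0 0
    have e1 := b1 l (by omega)
    have e2 := q2 (l + 1) (by omega)
    norm_num at this e1
    linarith
  intro x hx
  constructor
  · have := sup2d (gd 1 0) hx
    rw [g2, g1, g1] at this
    have k1 := gc 1 0
    have k2 := gc (1 + 1) 0
    have k3 := gc 1 (0 + 1)
    have k4 := gc (1 + 1) (0 + 1)
    rw [intO_add (by fun_prop) (by fun_prop), intO_add (by fun_prop) (by fun_prop),
      intO_add (by fun_prop) (by fun_prop)] at this
    have e1 := d0 0 (by norm_num)
    have e2 := d0 1 (by norm_num)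
    have e3 := d1 1 (by norm_num)
    have e4 := d1 2 (by norm_num)
    have e5 : g 1 0 x = pd1 w x := rfl
    rw [e5] at this
    norm_num at this e1 e2 e3 e4
    linarith
  · have := sup2d (gd 0 1) hx
    rw [g2, g1, g1] at this
    have k1 := gc 0 1
    have k2 := gc (0 + 1) 1
    have k3 := gc 0 (1 + 1)
    have k4 := gc (0 + 1) (1 + 1)
    rw [intO_add (by fun_prop) (by fun_prop), intO_add (by fun_prop) (by fun_prop),
      intO_add (by fun_prop) (by fun_prop)] at this
    have e1 := d1 0 (by norm_num)
    have e2 := d1 1 (by norm_num)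
    have e3 := d2 0 (by norm_num)
    have e4 := d2 1 (by norm_num)
    have e5 : g 0 1 x = pd2 w x := rfl
    rw [e5] at this
    norm_num at this e1 e2 e3 e4
    linarith

lemma evec_cases (k : Fin 2) : evec k = (1, 0) ∨ evec k = (0, 1) := by
  unfold evec; split_ifs <;> simp

lemma norm_fderiv_evec_sq_le {f : ℝ × ℝ → ℝ × ℝ} (x : ℝ × ℝ) (k : Fin 2) :
    ‖fderiv ℝ f x (evec k)‖ ^ 2 ≤ gradSq f x := by
  unfold gradSq pd1 pd2
  rcases evec_cases k with h | h <;> rw [h] <;> nlinarith [sq_nonneg ‖fderiv ℝ f x (1, 0)‖,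
    sq_nonneg ‖fderiv ℝ f x (0, 1)‖]

lemma SmoothFn.gradSq_cont {f : ℝ × ℝ → ℝ × ℝ} (hf : SmoothFn f) : Continuous (gradSq f) := by
  have h1 := hf.pd1.continuous'
  have h2 := hf.pd2.continuous'
  unfold gradSq
  fun_prop

/-- sup bound of `D ∂ₜ^{l₀} v` for `l₀ ≤ 1` -/
lemma Dv_sup {C₁ C₂ : ℝ} (hC₁ : 0 < C₁) {ρ : ℝ × ℝ → ℝ} (h : IsDensity C₁ C₂ ρ)
    {v : ℝ → ℝ × ℝ → ℝ × ℝ} (hv : SmoothT v) (t : ℝ) (l₀ : ℕ) (hl₀ : l₀ ≤ 1) (i k : Fin 2)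
    {x : ℝ × ℝ} (hx : x ∈ Oset) :
    (pdt^[l₀] (sdir (evec k) (vcmp i v)) t x) ^ 2 ≤
      3456 * (1 + 1 / C₁) ^ 4 * energy ρ v t := by
  have hρ : ∀ x ∈ Oset, 0 ≤ ρ x := fun x hx => density_nonneg hC₁ h hx
  have hρc : Continuous ρ := h.1.continuous'
  rw [pdt_iter_sdir (hv.vcmp i), pdt_iter_cmp hv]
  set f := (pdt^[l₀] v) t with hf
  have hfs : SmoothFn f := (hv.pdt_iter l₀).smoothFn t
  have hG := grad_sup (c := 1 + 1 / C₁) (E := energy ρ v t) (ρ := ρ)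
    (w := fun x => pick i (f x)) (by have := one_div_pos.2 hC₁; linarith) hρc hρ
    (fun x hx => qw_le hC₁ h hx) (hfs.pick i) ?_ ?_ ?_ x hx
  · unfold sdir
    have e : vcmp i (pdt^[l₀] v) t = fun x => pick i (f x) := rfl
    rw [e]
    rcases evec_cases k with h | h <;> rw [h]
    · exact hG.1
    · exact hG.2
  · intro l hl
    refine le_trans ?_ (en_b_le v t hρ (l₀ := l₀) (l₁ := l) (by omega) (by omega))
    rw [pd1_iter_pick hfs]
    have c1 := (hfs.pd1_iter (l + 1)).continuous'
    have c2 := (hfs.pd1_iter l).gradSq_cont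
    have c3 := (hfs.pd1_iter (l + 1)).gradSq_cont
    have c4 := ((hfs.pd1_iter (l + 1)).pick i).continuous'
    apply intO_mono (by fun_prop) (by fun_prop)
    intro y hy
    apply mul_le_mul_of_nonneg_left _ (hρ y hy)
    have e1 := abs_pick_le i ((pd1^[l + 1] f) y)
    have e2 : pick i ((pd1^[l + 1] f) y) ^ 2 ≤ ‖(pd1^[l + 1] f) y‖ ^ 2 := by
      rw [← sq_abs]; gcongr
    have e3 : ‖(pd1^[l + 1] f) y‖ ^ 2 ≤ gradSq (pd1^[l] f) y := by
      rw [Function.iterate_succ_apply']; unfold gradSq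
      nlinarith [sq_nonneg ‖pd2 (pd1^[l] f) y‖]
    have e4 := gradSq_nonneg (pd1^[l + 1] f) y
    linarith
  · intro l hl
    refine le_trans ?_ (en_b_le v t hρ (l₀ := l₀) (l₁ := l) (by omega) (by omega))
    rw [pd2_pick hfs, pd1_iter_pick hfs.pd2, ← pd2_pd1_iter hfs]
    have c2 := (hfs.pd1_iter l).gradSq_cont
    have c3 := (hfs.pd1_iter (l + 1)).gradSq_cont
    have c4 := ((hfs.pd1_iter l).pd2.pick i).continuous'
    apply intO_mono (by fun_prop) (by fun_prop)
    intro y hy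
    apply mul_le_mul_of_nonneg_left _ (hρ y hy)
    have e1 := abs_pick_le i (pd2 (pd1^[l] f) y)
    have e2 : pick i (pd2 (pd1^[l] f) y) ^ 2 ≤ ‖pd2 (pd1^[l] f) y‖ ^ 2 := by
      rw [← sq_abs]; gcongr
    have e3 : ‖pd2 (pd1^[l] f) y‖ ^ 2 ≤ gradSq (pd1^[l] f) y := by
      unfold gradSq
      nlinarith [sq_nonneg ‖pd1 (pd1^[l] f) y‖]
    have e4 := gradSq_nonneg (pd1^[l + 1] f) y
    linarith
  · intro l hl k hk hk'
    refine le_trans ?_ (en_c_le v t hρ (l₀ := l₀) (l₁ := l) (l₂ := k) (by omega) (by omega)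
      hk (by omega))
    rw [pd2_iter_pick hfs, pd1_iter_pick (hfs.pd2_iter k)]
    have c1 := ((hfs.pd2_iter k).pd1_iter l).continuous'
    have c4 := (((hfs.pd2_iter k).pd1_iter l).pick i).continuous'
    apply intO_mono (by fun_prop) (by fun_prop)
    intro y hy
    apply mul_le_mul_of_nonneg_left _ (pow_nonneg (hρ y hy) _)
    have e1 := abs_pick_le i ((pd1^[l] (pd2^[k] f)) y)
    rw [← sq_abs]; gcongr


/-! ### Calculus of time derivatives -/

/-- Weights controlling the time derivatives up to order four. -/
def bt (m2 m3 : ℝ) : ℕ → ℝ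
  | 0 => 1
  | 1 => 1
  | 2 => 1
  | 3 => 1 + m2
  | _ => 1 + m2 + m3

lemma bt_ge_one {m2 m3 : ℝ} (h2 : 0 ≤ m2) (h3 : 0 ≤ m3) (n : ℕ) : 1 ≤ bt m2 m3 n := by
  match n with
  | 0 => simp [bt]
  | 1 => simp [bt]
  | 2 => simp [bt]
  | 3 => simp [bt]; linarith
  | (n + 4) => simp [bt]; linarith

lemma bt_pos {m2 m3 : ℝ} (h2 : 0 ≤ m2) (h3 : 0 ≤ m3) (n : ℕ) : 0 < bt m2 m3 n :=
  lt_of_lt_of_le one_pos (bt_ge_one h2 h3 n)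

lemma bt_mul {m2 m3 : ℝ} (h2 : 0 ≤ m2) (h3 : 0 ≤ m3) (i j n : ℕ) (hn : i + j = n) (h : n ≤ 4) :
    bt m2 m3 i * bt m2 m3 j ≤ bt m2 m3 n := by
  have hi : i ≤ 4 := by omega
  have hj : j ≤ 4 := by omega
  subst hn
  interval_cases i <;> interval_cases j <;> first | omega | (simp [bt]; try linarith)

lemma bt_mul5 {m2 m3 : ℝ} (h2 : 0 ≤ m2) (h3 : 0 ≤ m3) (i j : ℕ) (hi : 1 ≤ i) (hj : 1 ≤ j)
    (h : i + j = 5) : bt m2 m3 i * bt m2 m3 j ≤ bt m2 m3 4 := by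
  have hi' : i ≤ 4 := by omega
  obtain rfl : j = 5 - i := by omega
  interval_cases i <;> (simp [bt]; try linarith)

/-- All time derivatives up to order four are controlled. -/
def Tame (m2 m3 L : ℝ) (f : ℝ → ℝ) (t : ℝ) : Prop :=
  ∀ j ≤ 4, |iteratedDeriv j f t| ≤ L * bt m2 m3 j

lemma cda {f : ℝ → ℝ} (hf : ContDiff ℝ ∞ f) (n : ℕ) (t : ℝ) : ContDiffAt ℝ (n : ℕ) f t :=
  (hf.of_le (by exact_mod_cast le_top)).contDiffAt

lemma Tame.mono {m2 m3 L L' t : ℝ} (h2 : 0 ≤ m2) (h3 : 0 ≤ m3) {f : ℝ → ℝ}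
    (h : Tame m2 m3 L f t) (hL : L ≤ L') : Tame m2 m3 L' f t := fun j hj =>
  (h j hj).trans (mul_le_mul_of_nonneg_right hL (bt_pos h2 h3 j).le)

lemma Tame.nonneg {m2 m3 L t : ℝ} {f : ℝ → ℝ}
    (h : Tame m2 m3 L f t) : 0 ≤ L := by
  have := h 0 (by norm_num)
  simp [bt] at this
  exact (abs_nonneg _).trans this

lemma Tame.add {m2 m3 L1 L2 t : ℝ} {f g : ℝ → ℝ} (hf : ContDiff ℝ ∞ f) (hg : ContDiff ℝ ∞ g)
    (h1 : Tame m2 m3 L1 f t) (h2 : Tame m2 m3 L2 g t) :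
    Tame m2 m3 (L1 + L2) (fun s => f s + g s) t := by
  intro j hj
  rw [iteratedDeriv_fun_add (cda hf j t) (cda hg j t), add_mul]
  exact (abs_add_le _ _).trans (add_le_add (h1 j hj) (h2 j hj))

lemma Tame.neg {m2 m3 L1 t : ℝ} {f : ℝ → ℝ}
    (h1 : Tame m2 m3 L1 f t) :
    Tame m2 m3 L1 (fun s => - f s) t := by
  intro j hj
  rw [iteratedDeriv_fun_neg, abs_neg]
  exact h1 j hj

lemma Tame.const {m2 m3 : ℝ} (h2 : 0 ≤ m2) (h3 : 0 ≤ m3) (c t : ℝ) :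
    Tame m2 m3 |c| (fun _ => c) t := by
  intro j hj
  rw [iteratedDeriv_const]
  have := bt_ge_one h2 h3 j
  split_ifs
  · nlinarith [abs_nonneg c]
  · simp; have := abs_nonneg c; positivity

lemma sum_choose_le (n : ℕ) {s : Finset ℕ} (hs : s ⊆ Finset.range (n + 1)) :
    ∑ i ∈ s, (n.choose i : ℝ) ≤ 2 ^ n := by
  calc ∑ i ∈ s, (n.choose i : ℝ) ≤ ∑ i ∈ Finset.range (n + 1), (n.choose i : ℝ) :=
        Finset.sum_le_sum_of_subset_of_nonneg hs (fun _ _ _ => by positivity)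
    _ = 2 ^ n := by exact_mod_cast Nat.sum_range_choose n

/-- Leibniz sums are bounded by `2^n`. -/
lemma leib_le (n : ℕ) (hn : n ≤ 4) {s : Finset ℕ} (hs : s ⊆ Finset.range (n + 1)) (a b : ℕ → ℝ)
    (c : ℝ) (hc : 0 ≤ c) (h : ∀ i ∈ s, |a i| * |b (n - i)| ≤ c) :
    |∑ i ∈ s, (n.choose i : ℝ) * a i * b (n - i)| ≤ 16 * c := by
  calc |∑ i ∈ s, (n.choose i : ℝ) * a i * b (n - i)|
      ≤ ∑ i ∈ s, |(n.choose i : ℝ) * a i * b (n - i)| := Finset.abs_sum_le_sum_abs _ _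
    _ ≤ ∑ i ∈ s, (n.choose i : ℝ) * c := by
        apply Finset.sum_le_sum
        intro i hi
        rw [abs_mul, abs_mul, mul_assoc, abs_of_nonneg (by positivity : (0:ℝ) ≤ (n.choose i : ℝ))]
        exact mul_le_mul_of_nonneg_left (h i hi) (by positivity)
    _ = (∑ i ∈ s, (n.choose i : ℝ)) * c := by rw [Finset.sum_mul]
    _ ≤ 16 * c := by
        apply mul_le_mul_of_nonneg_right _ hc
        refine (sum_choose_le n hs).trans ?_
        calc (2:ℝ) ^ n ≤ 2 ^ 4 := pow_le_pow_right₀ (by norm_num) hn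
          _ = 16 := by norm_num

lemma Tame.mul {m2 m3 L1 L2 t : ℝ} (h2 : 0 ≤ m2) (h3 : 0 ≤ m3) {f g : ℝ → ℝ}
    (hf : ContDiff ℝ ∞ f) (hg : ContDiff ℝ ∞ g)
    (k1 : Tame m2 m3 L1 f t) (k2 : Tame m2 m3 L2 g t) :
    Tame m2 m3 (16 * (L1 * L2)) (fun s => f s * g s) t := by
  intro j hj
  rw [iteratedDeriv_fun_mul (cda hf j t) (cda hg j t)]
  have hL1 := k1.nonneg
  have hL2 := k2.nonneg
  have hb := bt_pos h2 h3 j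
  rw [mul_assoc]
  refine leib_le j hj subset_rfl (fun i => iteratedDeriv i f t) (fun i => iteratedDeriv i g t) _
    (by positivity) ?_
  intro i hi
  have hi' : i ≤ j := by simpa [Nat.lt_succ_iff] using hi
  calc |iteratedDeriv i f t| * |iteratedDeriv (j - i) g t|
      ≤ (L1 * bt m2 m3 i) * (L2 * bt m2 m3 (j - i)) := by
        have := bt_pos h2 h3 i
        exact mul_le_mul (k1 i (by omega)) (k2 (j - i) (by omega)) (abs_nonneg _) (by positivity)
    _ = L1 * L2 * (bt m2 m3 i * bt m2 m3 (j - i)) := by ring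
    _ ≤ L1 * L2 * bt m2 m3 j :=
        mul_le_mul_of_nonneg_left (bt_mul h2 h3 i (j - i) j (by omega) hj) (by positivity)

lemma Tame.inv {m2 m3 M t : ℝ} (h2 : 0 ≤ m2) (h3 : 0 ≤ m3) {u J : ℝ → ℝ}
    (hu : ContDiff ℝ ∞ u) (hJ : ContDiff ℝ ∞ J) (hM : 1 ≤ M)
    (k : Tame m2 m3 M J t) (huJ : ∀ᶠ s in nhds t, u s * J s = 1) (hJt : 1 / 2 ≤ J t)  :
    Tame m2 m3 (2 * (32 * M) ^ 4) u t := by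
  have hlow : ∀ n ≤ 4, |iteratedDeriv n u t| ≤ 2 * (32 * M) ^ n * bt m2 m3 n := by
    intro n
    induction n using Nat.strong_induction_on with
    | _ n ih =>
    intro hn
    have hut : u t * J t = 1 := huJ.self_of_nhds
    have hut2 : |u t| ≤ 2 := by
      have : 0 < J t := by linarith
      have : u t = 1 / J t := by field_simp; exact hut
      rw [this, abs_of_pos (by positivity), div_le_iff₀ (by linarith)]
      linarith
    rcases Nat.eq_zero_or_pos n with rfl | hn0
    · simpa [bt] using hut2
    · have e : iteratedDeriv n (fun s => u s * J s) t = 0 := by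
        have : (fun s => u s * J s) =ᶠ[nhds t] fun _ => (1:ℝ) := huJ
        rw [this.iteratedDeriv_eq n, iteratedDeriv_const, if_neg (by omega)]
      rw [iteratedDeriv_fun_mul (cda hu n t) (cda hJ n t), Finset.sum_range_succ] at e
      simp only [Nat.choose_self, Nat.cast_one, one_mul, Nat.sub_self, iteratedDeriv_zero] at e
      have hb := bt_pos h2 h3 n
      have hs : |∑ i ∈ Finset.range n, (n.choose i : ℝ) * iteratedDeriv i u t *
          iteratedDeriv (n - i) J t| ≤ 16 * (2 * (32 * M) ^ (n - 1) * M * bt m2 m3 n) := by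
        refine leib_le n hn (Finset.range_subset_range.2 (by omega))
          (fun i => iteratedDeriv i u t) (fun i => iteratedDeriv i J t) _
          (by positivity) ?_
        intro i hi
        have hi' : i < n := by simpa using hi
        have := bt_pos h2 h3 i
        have := bt_pos h2 h3 (n - i)
        calc |iteratedDeriv i u t| * |iteratedDeriv (n - i) J t|
            ≤ (2 * (32 * M) ^ i * bt m2 m3 i) * (M * bt m2 m3 (n - i)) := by
              exact mul_le_mul (ih i hi' (by omega)) (k (n - i) (by omega)) (abs_nonneg _)
                (by positivity)
          _ = 2 * (32 * M) ^ i * M * (bt m2 m3 i * bt m2 m3 (n - i)) := by ring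
          _ ≤ 2 * (32 * M) ^ (n - 1) * M * bt m2 m3 n := by
              apply mul_le_mul _ (bt_mul h2 h3 i (n - i) n (by omega) hn) (by positivity)
                (by positivity)
              have : (32 * M) ^ i ≤ (32 * M) ^ (n - 1) :=
                pow_le_pow_right₀ (by linarith) (by omega)
              nlinarith
      have e2 : |iteratedDeriv n u t| * J t ≤
          16 * (2 * (32 * M) ^ (n - 1) * M * bt m2 m3 n) := by
        rw [← abs_of_pos (by linarith : 0 < J t), ← abs_mul]
        have : iteratedDeriv n u t * J t = -∑ i ∈ Finset.range n, (n.choose i : ℝ) *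
          iteratedDeriv i u t * iteratedDeriv (n - i) J t := by linarith
        rw [this, abs_neg]; exact hs
      have e3 : |iteratedDeriv n u t| * (1 / 2) ≤ |iteratedDeriv n u t| * J t :=
        mul_le_mul_of_nonneg_left hJt (abs_nonneg _)
      have e4 : (32 * M) ^ n = (32 * M) ^ (n - 1) * (32 * M) := by
        rw [← pow_succ]; congr 1; omega
      rw [e4]
      nlinarith
  intro j hj
  refine (hlow j hj).trans ?_
  apply mul_le_mul_of_nonneg_right _ (bt_pos h2 h3 j).le
  have : (32 * M) ^ j ≤ (32 * M) ^ 4 := pow_le_pow_right₀ (by linarith) hj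
  linarith

/-- Commutator estimate. -/
lemma Tame.comm {m2 m3 L1 L2 t : ℝ} (h2 : 0 ≤ m2) (h3 : 0 ≤ m3) {f g : ℝ → ℝ}
    (hf : ContDiff ℝ ∞ f) (hg : ContDiff ℝ ∞ g) (hL2 : 0 ≤ L2)
    (k1 : Tame m2 m3 L1 f t) (k2 : ∀ j ≤ 3, |iteratedDeriv j g t| ≤ L2 * bt m2 m3 (j + 1)) :
    |iteratedDeriv 4 (fun s => f s * g s) t - f t * iteratedDeriv 4 g t|
      ≤ 16 * (L1 * L2) * bt m2 m3 4 := by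
  rw [iteratedDeriv_fun_mul (cda hf 4 t) (cda hg 4 t)]
  have hL1 := k1.nonneg
  have hb := bt_pos h2 h3 4
  have e : ∑ i ∈ Finset.range (4 + 1), (Nat.choose 4 i : ℝ) * iteratedDeriv i f t *
      iteratedDeriv (4 - i) g t - f t * iteratedDeriv 4 g t =
      ∑ i ∈ Finset.Icc 1 4, (Nat.choose 4 i : ℝ) * iteratedDeriv i f t *
      iteratedDeriv (4 - i) g t := by
    have : Finset.range (4 + 1) = insert 0 (Finset.Icc 1 4) := by decide
    rw [this, Finset.sum_insert (by decide)]
    simp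
  rw [e, mul_assoc]
  refine leib_le 4 le_rfl (by decide) (fun i => iteratedDeriv i f t)
    (fun i => iteratedDeriv i g t) _ (by positivity) ?_
  intro i hi
  simp only [Finset.mem_Icc] at hi
  have := bt_pos h2 h3 i
  calc |iteratedDeriv i f t| * |iteratedDeriv (4 - i) g t|
      ≤ (L1 * bt m2 m3 i) * (L2 * bt m2 m3 (4 - i + 1)) := by
        exact mul_le_mul (k1 i (by omega)) (k2 (4 - i) (by omega)) (abs_nonneg _) (by positivity)
    _ = L1 * L2 * (bt m2 m3 i * bt m2 m3 (4 - i + 1)) := by ring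
    _ ≤ L1 * L2 * bt m2 m3 4 :=
        mul_le_mul_of_nonneg_left (bt_mul5 h2 h3 i (4 - i + 1) (by omega) (by omega) (by omega))
          (by positivity)

/-! ### The Lagrangian quantities -/

lemma SmoothT.addS {f g : ℝ → ℝ × ℝ → ℝ} (hf : SmoothT f) (hg : SmoothT g) :
    SmoothT (fun t x => f t x + g t x) := fun n => (hf n).add (hg n)

lemma SmoothT.subS {f g : ℝ → ℝ × ℝ → ℝ} (hf : SmoothT f) (hg : SmoothT g) :
    SmoothT (fun t x => f t x - g t x) := fun n => (hf n).sub (hg n)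

lemma SmoothT.mulS {f g : ℝ → ℝ × ℝ → ℝ} (hf : SmoothT f) (hg : SmoothT g) :
    SmoothT (fun t x => f t x * g t x) := fun n => (hf n).mul (hg n)

lemma SmoothT.negS {f : ℝ → ℝ × ℝ → ℝ} (hf : SmoothT f) :
    SmoothT (fun t x => - f t x) := fun n => (hf n).neg

lemma SmoothT.sumS {f : Fin 2 → ℝ → ℝ × ℝ → ℝ} (hf : ∀ j, SmoothT (f j)) :
    SmoothT (fun t x => ∑ j : Fin 2, f j t x) := fun n =>
  ContDiff.sum (fun j _ => hf j n)

lemma SmoothT.constS (c : ℝ) : SmoothT (fun _ _ => c) := fun _ => contDiff_const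

lemma SmoothFn.smoothT {ρ : ℝ × ℝ → ℝ} (h : SmoothFn ρ) : SmoothT (fun _ x => ρ x) :=
  fun n => (h n).comp contDiff_snd

/-- smooth global substitute of `z ↦ 1/z` -/
def hinv (z : ℝ) : ℝ := Real.smoothTransition (4 * z - 1) * z⁻¹

lemma hinv_eq {z : ℝ} (hz : 1 / 2 ≤ z) : hinv z = z⁻¹ := by
  unfold hinv
  rw [Real.smoothTransition.one_of_one_le (by linarith), one_mul]

lemma hinv_smooth : ContDiff ℝ ∞ hinv := by
  rw [contDiff_iff_contDiffAt]
  intro z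
  by_cases hz : z = 0
  · subst hz
    have : hinv =ᶠ[nhds 0] fun _ => (0:ℝ) := by
      filter_upwards [gt_mem_nhds (show (0:ℝ) < 1 / 4 by norm_num)] with y hy
      unfold hinv
      rw [Real.smoothTransition.zero_of_nonpos (by linarith), zero_mul]
    exact contDiffAt_const.congr_of_eventuallyEq this
  · unfold hinv
    apply ContDiffAt.mul
    · exact (Real.smoothTransition.contDiff (n := ⊤)).contDiffAt.comp z (by fun_prop)
    · exact contDiffAt_inv ℝ hz

lemma SmoothT.hinvS {f : ℝ → ℝ × ℝ → ℝ} (hf : SmoothT f) :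
    SmoothT (fun t x => hinv (f t x)) := by
  rw [smoothT_iff] at *
  exact hinv_smooth.comp hf

/-- entries of `Dη` -/
def Xd (v : ℝ → ℝ × ℝ → ℝ × ℝ) (i j : Fin 2) (t : ℝ) (x : ℝ × ℝ) : ℝ :=
  (if i = j then 1 else 0) + ∫ s in (0:ℝ)..t, sdir (evec j) (vcmp i v) s x

def Ad (v : ℝ → ℝ × ℝ → ℝ × ℝ) (i k : Fin 2) (t : ℝ) (x : ℝ × ℝ) : ℝ :=
  if i = 0 then (if k = 0 then Xd v 1 1 t x else - Xd v 1 0 t x)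
  else (if k = 0 then - Xd v 0 1 t x else Xd v 0 0 t x)

def Jd (v : ℝ → ℝ × ℝ → ℝ × ℝ) (t : ℝ) (x : ℝ × ℝ) : ℝ :=
  Xd v 0 0 t x * Xd v 1 1 t x + - (Xd v 0 1 t x * Xd v 1 0 t x)

def ud (v : ℝ → ℝ × ℝ → ℝ × ℝ) (t : ℝ) (x : ℝ × ℝ) : ℝ := hinv (Jd v t x)

def Phi (v : ℝ → ℝ × ℝ → ℝ × ℝ) (k j : Fin 2) (t : ℝ) (x : ℝ × ℝ) : ℝ :=
  ud v t x * ud v t x * (Ad v 0 k t x * Ad v 0 j t x + Ad v 1 k t x * Ad v 1 j t x)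

def Psd (v : ℝ → ℝ × ℝ → ℝ × ℝ) (i k : Fin 2) (t : ℝ) (x : ℝ × ℝ) : ℝ :=
  ud v t x * ud v t x * Ad v i k t x

def Hd (ρ : ℝ × ℝ → ℝ) (v : ℝ → ℝ × ℝ → ℝ × ℝ) (i k : Fin 2) (t : ℝ) (x : ℝ × ℝ) : ℝ :=
  Phi v k 0 t x * sdir (evec 0) (vcmp i v) t x + Phi v k 1 t x * sdir (evec 1) (vcmp i v) t x
    + - (ρ x * Psd v i k t x)

section smooth
variable {v : ℝ → ℝ × ℝ → ℝ × ℝ} (hv : SmoothT v)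

lemma Xd_smooth (hv : SmoothT v) (i j : Fin 2) : SmoothT (Xd v i j) :=
  (SmoothT.constS _).addS ((hv.vcmp i).sdir (evec j)).prim

lemma Ad_smooth (hv : SmoothT v) (i j : Fin 2) : SmoothT (Ad v i j) := by
  unfold Ad
  split_ifs
  · exact Xd_smooth hv 1 1
  · exact (Xd_smooth hv 1 0).negS
  · exact (Xd_smooth hv 0 1).negS
  · exact Xd_smooth hv 0 0

lemma Jd_smooth (hv : SmoothT v) : SmoothT (Jd v) :=
  ((Xd_smooth hv 0 0).mulS (Xd_smooth hv 1 1)).addS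
    ((Xd_smooth hv 0 1).mulS (Xd_smooth hv 1 0)).negS

lemma ud_smooth (hv : SmoothT v) : SmoothT (ud v) := (Jd_smooth hv).hinvS

lemma Phi_smooth (hv : SmoothT v) (k j : Fin 2) : SmoothT (Phi v k j) :=
  ((ud_smooth hv).mulS (ud_smooth hv)).mulS
    (((Ad_smooth hv 0 k).mulS (Ad_smooth hv 0 j)).addS
      ((Ad_smooth hv 1 k).mulS (Ad_smooth hv 1 j)))

lemma Psd_smooth (hv : SmoothT v) (k j : Fin 2) : SmoothT (Psd v k j) :=
  ((ud_smooth hv).mulS (ud_smooth hv)).mulS (Ad_smooth hv k j)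

lemma Hd_smooth {ρ : ℝ × ℝ → ℝ} (hρ : SmoothFn ρ) (hv : SmoothT v) (i k : Fin 2) :
    SmoothT (Hd ρ v i k) :=
  (((Phi_smooth hv k 0).mulS ((hv.vcmp i).sdir (evec 0))).addS
    ((Phi_smooth hv k 1).mulS ((hv.vcmp i).sdir (evec 1)))).addS
    (hρ.smoothT.mulS (Psd_smooth hv i k)).negS

end smooth

lemma per_fderiv {G : Type*} [NormedAddCommGroup G] [NormedSpace ℝ G] {f : ℝ × ℝ → G}
    (hf : Per f) (e : ℝ × ℝ) : Per (fun x => fderiv ℝ f x e) := by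
  intro x
  have h : (fun y => f (y + ((1:ℝ), (0:ℝ)))) = f := by
    funext y
    have := hf y
    rw [← this]
    congr 1
    ext <;> simp
  have h2 := fderiv_comp_add_right (𝕜 := ℝ) (f := f) (x := x) ((1:ℝ), (0:ℝ))
  rw [h] at h2
  have e1 : ((x.1 + 1, x.2) : ℝ × ℝ) = x + ((1:ℝ), (0:ℝ)) := by ext <;> simp
  simp only [e1, ← h2]

lemma perT_pdt {G : Type*} [NormedAddCommGroup G] [NormedSpace ℝ G] {f : ℝ → ℝ × ℝ → G}
    (hf : PerT f) : PerT (pdt f) := by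
  intro t x
  unfold pdt
  congr 1
  funext s
  exact hf s x

lemma perT_pdt_iter {G : Type*} [NormedAddCommGroup G] [NormedSpace ℝ G] {f : ℝ → ℝ × ℝ → G}
    (hf : PerT f) (n : ℕ) : PerT (pdt^[n] f) := by
  induction n with
  | zero => exact hf
  | succ n ih => rw [Function.iterate_succ_apply']; exact perT_pdt ih

lemma perT_vcmp {v : ℝ → ℝ × ℝ → ℝ × ℝ} (hv : PerT v) (i : Fin 2) : PerT (vcmp i v) := by
  intro t x
  unfold vcmp
  rw [hv t x]

lemma perT_Xd {v : ℝ → ℝ × ℝ → ℝ × ℝ} (hv : PerT v) (i j : Fin 2) : PerT (Xd v i j) := by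
  intro t x
  unfold Xd
  congr 2
  funext s
  exact per_fderiv (perT_vcmp hv i s) (evec j) x

lemma perT_Ad {v : ℝ → ℝ × ℝ → ℝ × ℝ} (hv : PerT v) (i j : Fin 2) : PerT (Ad v i j) := by
  intro t x
  unfold Ad
  simp only [perT_Xd hv _ _ t x]

lemma perT_Hd {ρ : ℝ × ℝ → ℝ} (hρ : Per ρ) {v : ℝ → ℝ × ℝ → ℝ × ℝ} (hv : PerT v)
    (i k : Fin 2) : PerT (Hd ρ v i k) := by
  intro t x
  have h : ∀ j, sdir (evec j) (vcmp i v) t (x.1 + 1, x.2) = sdir (evec j) (vcmp i v) t x :=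
    fun j => per_fderiv (perT_vcmp hv i t) (evec j) x
  unfold Hd Phi Psd ud Jd
  simp only [perT_Xd hv _ _ t x, perT_Ad hv _ _ t x, h, hρ x]

lemma flow_pick {v : ℝ → ℝ × ℝ → ℝ × ℝ} (hv : SmoothT v) (i : Fin 2) (t : ℝ) (x : ℝ × ℝ) :
    pick i (flowMap v t x) = pick i x + ∫ s in (0:ℝ)..t, vcmp i v s x := by
  unfold flowMap
  rw [← pickL_apply, map_add, pickL_apply]
  congr 1
  have := (pickL i).intervalIntegral_comp_comm (a := 0) (b := t) (μ := volume)
    (f := fun s => v s x) ((hv.contDiff_time x).continuous.intervalIntegrable _ _)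
  rw [← this]
  simp [pickL_apply, vcmp]

lemma pick_evec (i j : Fin 2) : pick i (evec j) = if i = j then 1 else 0 := by
  fin_cases i <;> fin_cases j <;> simp [pick, evec]

lemma flow_deriv {v : ℝ → ℝ × ℝ → ℝ × ℝ} (hv : SmoothT v) (i j : Fin 2) (t : ℝ) (x : ℝ × ℝ) :
    fderiv ℝ (fun y => pick i (flowMap v t y)) x (evec j) = Xd v i j t x := by
  have e : (fun y => pick i (flowMap v t y)) =
      fun y => pickL i y + (fun t x => ∫ s in (0:ℝ)..t, vcmp i v s x) t y := by
    funext y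
    rw [flow_pick hv, pickL_apply]
  have hd := (smoothFn_iff.1 ((hv.vcmp i).prim.smoothFn t)).differentiable (by simp) x
  rw [e, fderiv_fun_add (pickL i).differentiableAt hd]
  unfold Xd
  rw [← sdir_prim (hv.vcmp i), ContinuousLinearMap.fderiv]
  simp only [add_apply, pickL_apply, pick_evec]
  rfl

lemma pd1_flow {v : ℝ → ℝ × ℝ → ℝ × ℝ} (hv : SmoothT v) (t : ℝ) (x : ℝ × ℝ) :
    pd1 (fun y => (flowMap v t y).1) x = Xd v 0 0 t x ∧
    pd2 (fun y => (flowMap v t y).1) x = Xd v 0 1 t x ∧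
    pd1 (fun y => (flowMap v t y).2) x = Xd v 1 0 t x ∧
    pd2 (fun y => (flowMap v t y).2) x = Xd v 1 1 t x := by
  simp only [← flow_deriv hv]
  simp [pd1, pd2, pick, evec]

lemma cof_eq {v : ℝ → ℝ × ℝ → ℝ × ℝ} (hv : SmoothT v) (t : ℝ) (x : ℝ × ℝ) (i k : Fin 2) :
    cof (flowMap v t) x i k = Ad v i k t x := by
  obtain ⟨h1, h2, h3, h4⟩ := pd1_flow hv t x
  simp only [cof, Ad, h1, h2, h3, h4]

lemma jac_eq {v : ℝ → ℝ × ℝ → ℝ × ℝ} (hv : SmoothT v) (t : ℝ) (x : ℝ × ℝ) :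
    jac (flowMap v t) x = Jd v t x := by
  obtain ⟨h1, h2, h3, h4⟩ := pd1_flow hv t x
  simp only [jac, Jd, h1, h2, h3, h4]
  ring

lemma norm_evec_le (j : Fin 2) : ‖evec j‖ ≤ 1 := by
  fin_cases j <;> simp [evec, Prod.norm_def]

lemma Xd_close {ρ : ℝ × ℝ → ℝ} {v : ℝ → ℝ × ℝ → ℝ × ℝ} (hv : SmoothT v) {T M₁ c₁ c₂ : ℝ}
    (hA : Apriori ρ v T M₁ c₁ c₂) {t : ℝ} (ht : t ∈ Set.Icc (0:ℝ) T) {x : ℝ × ℝ} (hx : x ∈ Oset)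
    (i j : Fin 2) : |Xd v i j t x - (if i = j then 1 else 0)| ≤ 1 / 20 := by
  obtain ⟨h1, h2, hM, hT, hT1, hT2, hE, hD⟩ := hA
  have hb : ∀ s ∈ Set.uIoc (0:ℝ) t, ‖sdir (evec j) (vcmp i v) s x‖ ≤ c₁ * c₂ * √M₁ := by
    intro s hs
    rw [Set.uIoc_of_le ht.1] at hs
    have hs' : s ∈ Set.Icc (0:ℝ) T := ⟨hs.1.le, hs.2.trans ht.2⟩
    rw [sdir_cmp hv]
    calc ‖vcmp i (sdir (evec j) v) s x‖ ≤ ‖fderiv ℝ (v s) x (evec j)‖ := abs_pick_le _ _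
      _ ≤ ‖fderiv ℝ (v s) x‖ * ‖evec j‖ := ContinuousLinearMap.le_opNorm _ _
      _ ≤ ‖fderiv ℝ (v s) x‖ * 1 := by gcongr; exact norm_evec_le j
      _ ≤ c₁ * c₂ * √(energy ρ v s) := by rw [mul_one]; exact hD s hs' x hx
      _ ≤ c₁ * c₂ * √M₁ := by gcongr; exact hE s hs'
  have h3 := intervalIntegral.norm_integral_le_of_norm_le_const hb
  rw [sub_zero, abs_of_nonneg ht.1] at h3
  unfold Xd
  rw [add_sub_cancel_left]
  refine h3.trans ?_
  have hS : 0 ≤ c₁ * c₂ * √M₁ := by positivity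
  have hD0 : 0 ≤ 20 * c₁ * c₂ * √M₁ + 10 * c₁ ^ 2 * c₂ ^ 2 * M₁ := by positivity
  have hD1 : 0 < 20 * c₁ * c₂ * √M₁ + 10 * c₁ ^ 2 * c₂ ^ 2 * M₁ := by
    rcases hD0.eq_or_lt with h | h
    · rw [← h] at hT2; simp at hT2; linarith
    · exact h
  rw [le_div_iff₀ hD1] at hT2
  have h5 : 0 ≤ 10 * c₁ ^ 2 * c₂ ^ 2 * M₁ := by positivity
  have h6 : T * (20 * (c₁ * c₂ * √M₁)) ≤ 1 := by
    have := mul_nonneg hT.le h5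
    nlinarith
  have h7 : c₁ * c₂ * √M₁ * t ≤ c₁ * c₂ * √M₁ * T := mul_le_mul_of_nonneg_left ht.2 hS
  nlinarith

/-! ### Bounds on the coefficients and the differentiated equation -/

lemma Jd_bounds {v : ℝ → ℝ × ℝ → ℝ × ℝ} {t : ℝ} {x : ℝ × ℝ}
    (h : ∀ i j : Fin 2, |Xd v i j t x - (if i = j then 1 else 0)| ≤ 1 / 20) :
    9 / 10 ≤ Jd v t x ∧ Jd v t x ≤ 111 / 100 := by
  have h00 := abs_le.1 (h 0 0)
  have h01 := abs_le.1 (h 0 1)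
  have h10 := abs_le.1 (h 1 0)
  have h11 := abs_le.1 (h 1 1)
  simp at h00 h01 h10 h11
  unfold Jd
  constructor <;> nlinarith [mul_nonneg (sub_nonneg.2 h01.1) (sub_nonneg.2 h10.1)]

lemma quad_low {p q a b : ℝ} (hp : |p - 1| ≤ 1 / 20) (hq : |q| ≤ 1 / 20) :
    (9025 / 10000) * a ^ 2 - (525 / 10000) * (a ^ 2 + b ^ 2) ≤ (p * a - q * b) ^ 2 := by
  have hp' := abs_le.1 hp
  have h1 : (p * q) * (2 * (a * b)) ≤ (525 / 10000) * (a ^ 2 + b ^ 2) := by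
    calc (p * q) * (2 * (a * b)) ≤ |(p * q) * (2 * (a * b))| := le_abs_self _
      _ = (|p| * |q|) * (|2 * (a * b)|) := by rw [abs_mul, abs_mul]
      _ ≤ (105 / 100 * (1 / 20)) * (a ^ 2 + b ^ 2) := by
          have : |p| ≤ 105 / 100 := abs_le.2 ⟨by linarith, by linarith⟩
          have h3 : |2 * (a * b)| ≤ a ^ 2 + b ^ 2 := abs_le.2
            ⟨by nlinarith [sq_nonneg (a + b)], by nlinarith [sq_nonneg (a - b)]⟩
          gcongr
      _ = _ := by ring
  have h2 : 9025 / 10000 * a ^ 2 ≤ p ^ 2 * a ^ 2 := by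
    apply mul_le_mul_of_nonneg_right _ (sq_nonneg a)
    nlinarith
  nlinarith [sq_nonneg (q * b)]

lemma Phi_coercive {v : ℝ → ℝ × ℝ → ℝ × ℝ} {t : ℝ} {x : ℝ × ℝ}
    (h : ∀ i j : Fin 2, |Xd v i j t x - (if i = j then 1 else 0)| ≤ 1 / 20) (a b : ℝ) :
    1 / 2 * (a ^ 2 + b ^ 2) ≤ a * (Phi v 0 0 t x * a + Phi v 0 1 t x * b)
      + b * (Phi v 1 0 t x * a + Phi v 1 1 t x * b) := by
  obtain ⟨hJ1, hJ2⟩ := Jd_bounds h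
  have h00 := h 0 0
  have h01 := h 0 1
  have h10 := h 1 0
  have h11 := h 1 1
  simp at h00 h01 h10 h11
  have e : a * (Phi v 0 0 t x * a + Phi v 0 1 t x * b)
      + b * (Phi v 1 0 t x * a + Phi v 1 1 t x * b) =
      (ud v t x) ^ 2 * ((Xd v 1 1 t x * a - Xd v 1 0 t x * b) ^ 2 +
        (Xd v 0 0 t x * b - Xd v 0 1 t x * a) ^ 2) := by
    simp [Phi, Ad]; ring
  rw [e]
  have hu : 8 / 10 ≤ (ud v t x) ^ 2 := by
    unfold ud
    rw [hinv_eq (by linarith), inv_pow, ← one_div, le_div_iff₀ (by positivity)]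
    nlinarith
  have q1 := quad_low (a := a) (b := b) (p := Xd v 1 1 t x) (q := Xd v 1 0 t x)
    (by rw [one_div]; exact h11) (by rw [one_div]; exact h10)
  have q2 := quad_low (a := b) (b := a) (p := Xd v 0 0 t x) (q := Xd v 0 1 t x)
    (by rw [one_div]; exact h00) (by rw [one_div]; exact h01)
  have hs : 7 / 10 * (a ^ 2 + b ^ 2) ≤ (Xd v 1 1 t x * a - Xd v 1 0 t x * b) ^ 2 +
        (Xd v 0 0 t x * b - Xd v 0 1 t x * a) ^ 2 := by nlinarith [sq_nonneg a, sq_nonneg b]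
  calc 1 / 2 * (a ^ 2 + b ^ 2) ≤ 8 / 10 * (7 / 10 * (a ^ 2 + b ^ 2)) := by
        nlinarith [sq_nonneg a, sq_nonneg b]
    _ ≤ _ := by gcongr

lemma pde1 {C₁ C₂ : ℝ} {ρ : ℝ × ℝ → ℝ} (hρ : IsDensity C₁ C₂ ρ) {v : ℝ → ℝ × ℝ → ℝ × ℝ}
    (hv : SmoothT v) {T M₁ c₁ c₂ : ℝ} (hA : Apriori ρ v T M₁ c₁ c₂) (hS : IsLagSol ρ v T)
    {t : ℝ} (ht0 : 0 < t) (htT : t ≤ T) {x : ℝ × ℝ} (hx : x ∈ Oset) (i : Fin 2) :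
    ρ x * pdt (vcmp i v) t x =
      ∑ k : Fin 2, sdir (evec k) (fun t y => ρ y * Hd ρ v i k t y) t x := by
  have h := hS t ht0 htT x hx i
  have hud : ∀ y ∈ Oset, jac (flowMap v t) y ^ (-2 : ℤ) = ud v t y * ud v t y := by
    intro y hy
    have hJ := (Jd_bounds (Xd_close hv hA ⟨ht0.le, htT⟩ hy)).1
    rw [jac_eq hv, ud, hinv_eq (by linarith), zpow_neg]
    have : (Jd v t y) ^ (2:ℤ) = Jd v t y * Jd v t y := by
      rw [show (2:ℤ) = ((2:ℕ):ℤ) by rfl, zpow_natCast, pow_two]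
    rw [this, mul_inv]
  have hO := isOpen_Oset.mem_nhds hx
  have e1 : ∀ k : Fin 2, pdk k (fun y => ρ y ^ 2 * jac (flowMap v t) y ^ (-2 : ℤ) *
      cof (flowMap v t) y i k) x = sdir (evec k) (fun t y => ρ y * (ρ y * Psd v i k t y)) t x := by
    intro k
    unfold pdk sdir
    rw [Filter.EventuallyEq.fderiv_eq]
    filter_upwards [hO] with y hy
    rw [hud y hy, cof_eq hv]
    unfold Psd
    ring
  have e2 : ∀ k : Fin 2, pdk k (fun y => ρ y * jac (flowMap v t) y ^ (-2 : ℤ) *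
            ∑ j : Fin 2, bmat (flowMap v t) y k j * pdk j (fun z => pick i (v t z)) y) x =
      sdir (evec k) (fun t y => ρ y * (Phi v k 0 t y * sdir (evec 0) (vcmp i v) t y
        + Phi v k 1 t y * sdir (evec 1) (vcmp i v) t y)) t x := by
    intro k
    unfold pdk
    rw [sdir, Filter.EventuallyEq.fderiv_eq]
    filter_upwards [hO] with y hy
    rw [hud y hy]
    simp only [bmat, cof_eq hv, Fin.sum_univ_two, Phi, sdir]
    unfold vcmp
    ring
  have e3 : ∀ k : Fin 2, sdir (evec k) (fun t y => ρ y * Hd ρ v i k t y) t x =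
      sdir (evec k) (fun t y => ρ y * (Phi v k 0 t y * sdir (evec 0) (vcmp i v) t y
        + Phi v k 1 t y * sdir (evec 1) (vcmp i v) t y)) t x
      - sdir (evec k) (fun t y => ρ y * (ρ y * Psd v i k t y)) t x := by
    intro k
    have d1 : SmoothT (fun t y => ρ y * (Phi v k 0 t y * sdir (evec 0) (vcmp i v) t y
        + Phi v k 1 t y * sdir (evec 1) (vcmp i v) t y)) :=
      hρ.1.smoothT.mulS (((Phi_smooth hv k 0).mulS ((hv.vcmp i).sdir (evec 0))).addS
        ((Phi_smooth hv k 1).mulS ((hv.vcmp i).sdir (evec 1))))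
    have d2 : SmoothT (fun t y => ρ y * (ρ y * Psd v i k t y)) :=
      hρ.1.smoothT.mulS (hρ.1.smoothT.mulS (Psd_smooth hv i k))
    have := fderiv_fun_sub ((smoothFn_iff.1 (d1.smoothFn t)).differentiable (by simp) x)
      ((smoothFn_iff.1 (d2.smoothFn t)).differentiable (by simp) x)
    rw [sdir, sdir, sdir, ← sub_apply, ← this]
    congr 2
    funext y
    unfold Hd
    ring
  simp only [e1, e2] at h
  simp only [e3, Finset.sum_sub_distrib]
  rw [pdt_cmp hv]
  unfold vcmp
  unfold vcmp at h
  linarith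

lemma pdt_iter_static {ρ : ℝ × ℝ → ℝ} (f : ℝ → ℝ × ℝ → ℝ) (n : ℕ) :
    pdt^[n] (fun t y => ρ y * f t y) = fun t y => ρ y * (pdt^[n] f) t y := by
  funext t y
  rw [pdt_iter_eq, pdt_iter_eq, iteratedDeriv_const_mul_field]

lemma pde4 {C₁ C₂ : ℝ} {ρ : ℝ × ℝ → ℝ} (hρ : IsDensity C₁ C₂ ρ) {v : ℝ → ℝ × ℝ → ℝ × ℝ}
    (hv : SmoothT v) {T M₁ c₁ c₂ : ℝ} (hA : Apriori ρ v T M₁ c₁ c₂) (hS : IsLagSol ρ v T)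
    {t : ℝ} (ht0 : 0 < t) (htT : t < T) {x : ℝ × ℝ} (hx : x ∈ Oset) (i : Fin 2) :
    ρ x * pdt (pdt^[4] (vcmp i v)) t x =
      ∑ k : Fin 2, fderiv ℝ (fun y => ρ y * (pdt^[4] (Hd ρ v i k)) t y) x (evec k) := by
  have hev : (fun s => ρ x * pdt (vcmp i v) s x) =ᶠ[nhds t] fun s =>
      ∑ k : Fin 2, sdir (evec k) (fun t y => ρ y * Hd ρ v i k t y) s x := by
    filter_upwards [Ioo_mem_nhds ht0 htT] with s hs
    exact pde1 hρ hv hA hS hs.1 hs.2.le hx i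
  have hsm : ∀ k, SmoothT (fun t y => ρ y * Hd ρ v i k t y) := fun k =>
    hρ.1.smoothT.mulS (Hd_smooth hρ.1 hv i k)
  have h4 := hev.iteratedDeriv_eq 4
  rw [iteratedDeriv_const_mul_field, iteratedDeriv_fun_sum
    (fun k _ => cda (((hsm k).sdir (evec k)).contDiff_time x) 4 t), ← pdt_iter_eq] at h4
  have e1 : pdt^[4] (pdt (vcmp i v)) = pdt (pdt^[4] (vcmp i v)) := by
    rw [← Function.iterate_succ_apply, Function.iterate_succ_apply']
  rw [e1] at h4
  rw [h4]
  apply Finset.sum_congr rfl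
  intro k _
  rw [← pdt_iter_eq, pdt_iter_sdir (hsm k), pdt_iter_static]
  rfl

/-! ### Remainder bound -/

lemma pdt_Xd {v : ℝ → ℝ × ℝ → ℝ × ℝ} (hv : SmoothT v) (i j : Fin 2) :
    pdt (Xd v i j) = sdir (evec j) (vcmp i v) := by
  rw [← pdt_prim ((hv.vcmp i).sdir (evec j))]
  funext t x
  unfold pdt Xd
  rw [deriv_const_add]

lemma iter_Xd {v : ℝ → ℝ × ℝ → ℝ × ℝ} (hv : SmoothT v) (i j : Fin 2) (n : ℕ) (t : ℝ)
    (x : ℝ × ℝ) : iteratedDeriv (n + 1) (fun s => Xd v i j s x) t =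
      iteratedDeriv n (fun s => sdir (evec j) (vcmp i v) s x) t := by
  rw [← pdt_iter_eq, ← pdt_iter_eq, Function.iterate_succ_apply, pdt_Xd hv]

lemma iter_sdir_le {v : ℝ → ℝ × ℝ → ℝ × ℝ} (hv : SmoothT v) (i j : Fin 2) (n : ℕ) (t : ℝ)
    (x : ℝ × ℝ) : |iteratedDeriv n (fun s => sdir (evec j) (vcmp i v) s x) t| ≤
      √(gradSq ((pdt^[n] v) t) x) := by
  rw [← pdt_iter_eq, pdt_iter_sdir (hv.vcmp i), pdt_iter_cmp hv, sdir_cmp (hv.pdt_iter n)]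
  apply Real.le_sqrt_of_sq_le
  rw [sq_abs]
  refine le_trans ?_ (norm_fderiv_evec_sq_le x j)
  rw [← sq_abs]
  exact pow_le_pow_left₀ (abs_nonneg _) (abs_pick_le _ _) 2

section rem
variable {v : ℝ → ℝ × ℝ → ℝ × ℝ}

lemma dv_tame (hv : SmoothT v) {m2 m3 L t : ℝ} (h2 : 0 ≤ m2) (h3 : 0 ≤ m3) {x : ℝ × ℝ}
    (hm2 : √(gradSq ((pdt^[2] v) t) x) ≤ m2) (hm3 : √(gradSq ((pdt^[3] v) t) x) ≤ m3)
    (hL : 1 ≤ L)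
    (h : ∀ l ≤ 1, ∀ i j, |(pdt^[l] (sdir (evec j) (vcmp i v))) t x| ≤ L) (i j : Fin 2) (n : ℕ)
    (hn : n ≤ 3) :
    |iteratedDeriv n (fun s => sdir (evec j) (vcmp i v) s x) t| ≤ L * bt m2 m3 (n + 1) := by
  rcases Nat.lt_or_ge n 2 with hn2 | hn2
  · rw [← pdt_iter_eq]
    refine (h n (by omega) i j).trans ?_
    have := bt_ge_one h2 h3 (n + 1)
    nlinarith
  · have k := iter_sdir_le hv i j n t x
    obtain rfl | rfl : n = 2 ∨ n = 3 := by omega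
    · simp only [bt]; nlinarith
    · simp only [bt]; nlinarith

lemma Xd_tame (hv : SmoothT v) {m2 m3 L t : ℝ} (h2 : 0 ≤ m2) (h3 : 0 ≤ m3) {x : ℝ × ℝ}
    (hm2 : √(gradSq ((pdt^[2] v) t) x) ≤ m2) (hm3 : √(gradSq ((pdt^[3] v) t) x) ≤ m3)
    (hL : 2 ≤ L)
    (h : ∀ l ≤ 1, ∀ i j, |(pdt^[l] (sdir (evec j) (vcmp i v))) t x| ≤ L)
    (hc : ∀ i j : Fin 2, |Xd v i j t x - (if i = j then 1 else 0)| ≤ 1 / 20) (i j : Fin 2) :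
    Tame m2 m3 L (fun s => Xd v i j s x) t := by
  intro n hn
  match n, hn with
  | 0, _ =>
    simp only [iteratedDeriv_zero, bt]
    have := abs_le.1 (hc i j)
    rw [abs_le]
    split_ifs at this <;> constructor <;> linarith
  | (n + 1), hn =>
    rw [iter_Xd hv]
    exact dv_tame hv h2 h3 hm2 hm3 (by linarith) h i j n (by omega)

lemma Ad_tame {m2 m3 L t : ℝ} {x : ℝ × ℝ}
    (hX : ∀ i j, Tame m2 m3 L (fun s => Xd v i j s x) t) (i j : Fin 2) :
    Tame m2 m3 L (fun s => Ad v i j s x) t := by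
  unfold Ad
  split_ifs
  · exact hX 1 1
  · exact (hX 1 0).neg
  · exact (hX 0 1).neg
  · exact hX 0 0

lemma ud_tame (hv : SmoothT v) {m2 m3 L t : ℝ} (h2 : 0 ≤ m2) (h3 : 0 ≤ m3) {x : ℝ × ℝ}
    (hL : 2 ≤ L) (hX : ∀ i j, Tame m2 m3 L (fun s => Xd v i j s x) t)
    (hJ : ∀ᶠ s in nhds t, 1 / 2 ≤ Jd v s x) :
    Tame m2 m3 (16 * (2 ^ 82 * L ^ 16)) (fun s => ud v s x * ud v s x) t := by
  have cX := fun i j => (Xd_smooth hv i j).contDiff_time x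
  have tJ : Tame m2 m3 (32 * L ^ 2) (fun s => Jd v s x) t := by
    have := ((hX 0 0).mul h2 h3 (cX 0 0) (cX 1 1) (hX 1 1)).add
      ((cX 0 0).mul (cX 1 1)) ((cX 0 1).mul (cX 1 0)).neg
      ((hX 0 1).mul h2 h3 (cX 0 1) (cX 1 0) (hX 1 0)).neg
    exact this.mono h2 h3 (by nlinarith)
  have cu := (ud_smooth hv).contDiff_time x
  have tu := tJ.inv h2 h3 cu ((Jd_smooth hv).contDiff_time x) (by nlinarith) (by
    filter_upwards [hJ] with s hs
    unfold ud
    rw [hinv_eq hs, inv_mul_cancel₀ (by linarith)]) hJ.self_of_nhds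
  exact (tu.mul h2 h3 cu cu tu).mono h2 h3 (by ring_nf; exact le_rfl)

lemma Phi_tame (hv : SmoothT v) {m2 m3 L t : ℝ} (h2 : 0 ≤ m2) (h3 : 0 ≤ m3) {x : ℝ × ℝ}
    (hL : 2 ≤ L) (hX : ∀ i j, Tame m2 m3 L (fun s => Xd v i j s x) t)
    (hJ : ∀ᶠ s in nhds t, 1 / 2 ≤ Jd v s x) (k j : Fin 2) :
    Tame m2 m3 (2 ^ 95 * L ^ 18) (fun s => Phi v k j s x) t := by
  have cA := fun i j => (Ad_smooth hv i j).contDiff_time x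
  have tA := Ad_tame hX
  have cu := (ud_smooth hv).contDiff_time x
  have tu := ud_tame hv h2 h3 hL hX hJ
  have := tu.mul h2 h3 (cu.mul cu) (((cA 0 k).mul (cA 0 j)).add ((cA 1 k).mul (cA 1 j)))
    (((tA 0 k).mul h2 h3 (cA 0 k) (cA 0 j) (tA 0 j)).add ((cA 0 k).mul (cA 0 j))
      ((cA 1 k).mul (cA 1 j)) ((tA 1 k).mul h2 h3 (cA 1 k) (cA 1 j) (tA 1 j)))
  exact this.mono h2 h3 (by ring_nf; exact le_rfl)

lemma Psd_tame (hv : SmoothT v) {m2 m3 L t : ℝ} (h2 : 0 ≤ m2) (h3 : 0 ≤ m3) {x : ℝ × ℝ}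
    (hL : 2 ≤ L) (hX : ∀ i j, Tame m2 m3 L (fun s => Xd v i j s x) t)
    (hJ : ∀ᶠ s in nhds t, 1 / 2 ≤ Jd v s x) (k j : Fin 2) :
    Tame m2 m3 (2 ^ 90 * L ^ 17) (fun s => Psd v k j s x) t := by
  have cA := fun i j => (Ad_smooth hv i j).contDiff_time x
  have tA := Ad_tame hX
  have cu := (ud_smooth hv).contDiff_time x
  have tu := ud_tame hv h2 h3 hL hX hJ
  have := tu.mul h2 h3 (cu.mul cu) (cA k j) (tA k j)
  exact this.mono h2 h3 (by ring_nf; exact le_rfl)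

lemma rem_le (hv : SmoothT v) {m2 m3 L t C₂ : ℝ} (h2 : 0 ≤ m2) (h3 : 0 ≤ m3) {x : ℝ × ℝ}
    {ρ : ℝ × ℝ → ℝ} (hr0 : 0 ≤ ρ x) (hr : ρ x ≤ C₂)
    (hm2 : √(gradSq ((pdt^[2] v) t) x) ≤ m2) (hm3 : √(gradSq ((pdt^[3] v) t) x) ≤ m3)
    (hL : 2 ≤ L)
    (h : ∀ l ≤ 1, ∀ i j, |(pdt^[l] (sdir (evec j) (vcmp i v))) t x| ≤ L)
    (hc : ∀ i j : Fin 2, |Xd v i j t x - (if i = j then 1 else 0)| ≤ 1 / 20)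
    (hJ : ∀ᶠ s in nhds t, 1 / 2 ≤ Jd v s x) (i k : Fin 2) :
    |(pdt^[4] (Hd ρ v i k)) t x -
      (Phi v k 0 t x * sdir (evec 0) (pdt^[4] (vcmp i v)) t x +
        Phi v k 1 t x * sdir (evec 1) (pdt^[4] (vcmp i v)) t x)| ≤
      2 ^ 100 * (1 + C₂) * L ^ 19 * bt m2 m3 4 := by
  have hX := Xd_tame hv h2 h3 hm2 hm3 hL h hc
  have cP := fun j => (Phi_smooth hv k j).contDiff_time x
  have cD := fun j => ((hv.vcmp i).sdir (evec j)).contDiff_time x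
  have cm := fun j => (Phi_tame hv h2 h3 hL hX hJ k j).comm h2 h3 (cP j) (cD j)
    (by linarith : 0 ≤ L)
    (fun n hn => dv_tame hv h2 h3 hm2 hm3 (by linarith) h i j n hn)
  have cQ := (Psd_smooth hv i k).contDiff_time x
  have tQ := Psd_tame hv h2 h3 hL hX hJ i k 4 le_rfl
  have e : (pdt^[4] (Hd ρ v i k)) t x =
      iteratedDeriv 4 (fun s => Phi v k 0 s x * sdir (evec 0) (vcmp i v) s x) t +
      iteratedDeriv 4 (fun s => Phi v k 1 s x * sdir (evec 1) (vcmp i v) s x) t +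
      - (ρ x * iteratedDeriv 4 (fun s => Psd v i k s x) t) := by
    rw [pdt_iter_eq]
    unfold Hd
    rw [iteratedDeriv_fun_add (cda (((cP 0).mul (cD 0)).add ((cP 1).mul (cD 1))) 4 t)
      (cda (contDiff_const.mul cQ).neg 4 t),
      iteratedDeriv_fun_add (cda ((cP 0).mul (cD 0)) 4 t) (cda ((cP 1).mul (cD 1)) 4 t),
      iteratedDeriv_fun_neg, iteratedDeriv_const_mul_field]
  have e2 : ∀ j, iteratedDeriv 4 (fun s => sdir (evec j) (vcmp i v) s x) t =
      sdir (evec j) (pdt^[4] (vcmp i v)) t x := by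
    intro j
    rw [← pdt_iter_eq, pdt_iter_sdir (hv.vcmp i)]
  simp only [e2] at cm
  have c0 := cm 0
  have c1 := cm 1
  rw [e]
  have hb := bt_pos h2 h3 4
  set b := bt m2 m3 4
  set q := iteratedDeriv 4 (fun s => Psd v i k s x) t
  have hq : |ρ x * q| ≤ C₂ * (2 ^ 90 * L ^ 17 * b) := by
    rw [abs_mul, abs_of_nonneg hr0]
    exact mul_le_mul hr tQ (abs_nonneg _) (hr0.trans hr)
  have hC : 0 ≤ C₂ := hr0.trans hr
  have hL19 : L ^ 17 ≤ L ^ 19 := pow_le_pow_right₀ (by linarith) (by norm_num)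
  have k1 : C₂ * (2 ^ 90 * L ^ 17 * b) ≤ C₂ * (2 ^ 100 * L ^ 19 * b) := by
    gcongr
    · norm_num
    · norm_num
  have e3 : 16 * (2 ^ 95 * L ^ 18 * L) * b = 2 ^ 99 * L ^ 19 * b := by ring
  rw [e3] at c0 c1
  rw [abs_le] at *
  constructor <;> nlinarith
end rem

/-! ### Energy estimate -/

lemma ibp {C₁ C₂ : ℝ} {ρ : ℝ × ℝ → ℝ} (hρ : IsDensity C₁ C₂ ρ) {W G : ℝ × ℝ → ℝ}
    (hW : ContDiff ℝ ∞ W) (hG : ContDiff ℝ ∞ G) (pW : Per W) (pG : Per G) (k : Fin 2) :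
    ∫ x in Oset, W x * fderiv ℝ (fun y => ρ y * G y) x (evec k) =
      - ∫ x in Oset, ρ x * (fderiv ℝ W x (evec k) * G x) := by
  have hr := smoothFn_iff.1 hρ.1
  have hrG : ContDiff ℝ ∞ (fun y => ρ y * G y) := hr.mul hG
  have hF : ContDiff ℝ ∞ (fun y => W y * (ρ y * G y)) := hW.mul hrG
  have h0 : ∫ x in Oset, fderiv ℝ (fun y => W y * (ρ y * G y)) x (evec k) = 0 := by
    rcases evec_cases k with h | h <;> rw [h]
    · apply int_d1_zero hF
      intro x
      simp only [pW x, pG x, hρ.2.1 x]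
    · apply int_d2_zero hF
      · intro a
        have : ρ (a, 0) = 0 := hρ.2.2.1 _ (Or.inl rfl)
        simp [this]
      · intro a
        have : ρ (a, 1) = 0 := hρ.2.2.1 _ (Or.inr rfl)
        simp [this]
  have e : ∀ x, fderiv ℝ (fun y => W y * (ρ y * G y)) x (evec k) =
      W x * fderiv ℝ (fun y => ρ y * G y) x (evec k) + ρ x * (fderiv ℝ W x (evec k) * G x) := by
    intro x
    rw [fderiv_fun_mul (hW.differentiable (by simp) x) (hrG.differentiable (by simp) x)]
    simp only [add_apply, smul_apply, smul_eq_mul]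
    ring
  simp only [e] at h0
  have c1 := (contDiff_dir hrG (evec k)).continuous
  have c2 := (contDiff_dir hW (evec k)).continuous
  have c3 := hW.continuous
  have c4 := hG.continuous
  have c5 := hr.continuous
  rw [intO_add (by fun_prop) (by fun_prop)] at h0
  linarith

lemma ibp2 {C₁ C₂ : ℝ} {ρ : ℝ × ℝ → ℝ} (hρ : IsDensity C₁ C₂ ρ) {W Wt G0 G1 : ℝ × ℝ → ℝ}
    (hW : ContDiff ℝ ∞ W) (hG0 : ContDiff ℝ ∞ G0) (hG1 : ContDiff ℝ ∞ G1) (pW : Per W)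
    (pG0 : Per G0) (pG1 : Per G1)
    (h : ∀ x ∈ Oset, ρ x * Wt x = fderiv ℝ (fun y => ρ y * G0 y) x (evec 0) +
      fderiv ℝ (fun y => ρ y * G1 y) x (evec 1)) :
    ∫ x in Oset, ρ x * (W x * Wt x) =
      ∫ x in Oset, ρ x * (-(fderiv ℝ W x (evec 0) * G0 x) - fderiv ℝ W x (evec 1) * G1 x) := by
  have hr := smoothFn_iff.1 hρ.1
  have cr := hr.continuous
  have cW := hW.continuous
  have cH0 := hG0.continuous
  have cH1 := hG1.continuous
  have cd0 := (contDiff_dir hW (evec 0)).continuous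
  have cd1 := (contDiff_dir hW (evec 1)).continuous
  have crH0 := (contDiff_dir (hr.mul hG0) (evec 0)).continuous
  have crH1 := (contDiff_dir (hr.mul hG1) (evec 1)).continuous
  have e1 : ∫ x in Oset, ρ x * (W x * Wt x) =
      ∫ x in Oset, (W x * fderiv ℝ (fun y => ρ y * G0 y) x (evec 0)
        + W x * fderiv ℝ (fun y => ρ y * G1 y) x (evec 1)) := by
    apply setIntegral_congr_fun measurableSet_Oset
    intro x hx
    simp only
    calc ρ x * (W x * Wt x) = W x * (ρ x * Wt x) := by ring
      _ = _ := by rw [h x hx, mul_add]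
  rw [e1, intO_add (cW.fun_mul crH0) (cW.fun_mul crH1), ibp hρ hW hG0 pW pG0 0, ibp hρ hW hG1 pW pG1 1]
  have e2 : ∀ x, ρ x * (-(fderiv ℝ W x (evec 0) * G0 x) - fderiv ℝ W x (evec 1) * G1 x) =
      (-(ρ x * (fderiv ℝ W x (evec 0) * G0 x))) - ρ x * (fderiv ℝ W x (evec 1) * G1 x) := by
    intro x; ring
  simp only [e2]
  rw [intO_sub (cr.fun_mul (cd0.fun_mul cH0)).fun_neg (cr.fun_mul (cd1.fun_mul cH1)), integral_neg]
  ring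

lemma bt4_sq {m2 m3 : ℝ} : bt m2 m3 4 ^ 2 ≤ 3 * (1 + m2 ^ 2 + m3 ^ 2) := by
  simp only [bt]
  nlinarith [sq_nonneg (1 - m2), sq_nonneg (1 - m3), sq_nonneg (m2 - m3)]

/-- the constant in the sup bound -/
def Kc (C₁ : ℝ) : ℝ := 60 * (1 + 1 / C₁) ^ 2

lemma Kc_ge {C₁ : ℝ} (h : 0 < C₁) : 60 ≤ Kc C₁ := by
  unfold Kc
  have : 0 < 1 / C₁ := by positivity
  nlinarith

lemma sup_L {C₁ C₂ : ℝ} (hC₁ : 0 < C₁) {ρ : ℝ × ℝ → ℝ} (h : IsDensity C₁ C₂ ρ)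
    {v : ℝ → ℝ × ℝ → ℝ × ℝ} (hv : SmoothT v) {t Z : ℝ} (hZ : 0 ≤ Z) (hE : energy ρ v t ≤ Z ^ 2)
    {x : ℝ × ℝ} (hx : x ∈ Oset) (l : ℕ) (hl : l ≤ 1) (i j : Fin 2) :
    |(pdt^[l] (sdir (evec j) (vcmp i v))) t x| ≤ Kc C₁ * (1 + Z) := by
  have h1 := Dv_sup hC₁ h hv t l hl i j hx
  have hp : 0 < 1 + 1 / C₁ := by positivity
  apply abs_le_of_sq_le_sq _ (by unfold Kc; positivity)
  refine h1.trans ?_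
  calc 3456 * (1 + 1 / C₁) ^ 4 * energy ρ v t ≤ 3600 * (1 + 1 / C₁) ^ 4 * (1 + Z) ^ 2 := by
        have : energy ρ v t ≤ (1 + Z) ^ 2 := by nlinarith
        have e0 := energy_nonneg v t (ρ := ρ) (fun x hx => density_nonneg hC₁ h hx)
        gcongr
        norm_num
    _ = (Kc C₁ * (1 + Z)) ^ 2 := by unfold Kc; ring

/-- the remainder constant -/
def Cr (C₁ C₂ Z : ℝ) : ℝ := 2 ^ 100 * (1 + C₂) * (Kc C₁ * (1 + Z)) ^ 19

lemma ptwise {a b F0 F1 f0 f1 B : ℝ} (h : 1 / 2 * (a ^ 2 + b ^ 2) ≤ a * f0 + b * f1)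
    (h0 : |F0 - f0| ≤ B) (h1 : |F1 - f1| ≤ B) :
    -(a * F0) - b * F1 ≤ - (1 / 4) * (a ^ 2 + b ^ 2) + 2 * B ^ 2 := by
  have k0 : (F0 - f0) ^ 2 ≤ B ^ 2 := sq_le_sq' (by linarith [(abs_le.1 h0).1]) (abs_le.1 h0).2
  have k1 : (F1 - f1) ^ 2 ≤ B ^ 2 := sq_le_sq' (by linarith [(abs_le.1 h1).1]) (abs_le.1 h1).2
  nlinarith [sq_nonneg (1 / 2 * a + (F0 - f0)), sq_nonneg (1 / 2 * b + (F1 - f1))]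

section est
variable {C₁ C₂ : ℝ} {ρ : ℝ × ℝ → ℝ} {v : ℝ → ℝ × ℝ → ℝ × ℝ} {T M₁ c₁ c₂ : ℝ}

lemma grad_energy (hC₁ : 0 < C₁) (hρ : IsDensity C₁ C₂ ρ) (hv : SmoothT v) (t : ℝ) {l : ℕ}
    (hl : l < 4) : ∫ x in Oset, ρ x * gradSq ((pdt^[l] v) t) x ≤ energy ρ v t := by
  have hρ0 : ∀ x ∈ Oset, 0 ≤ ρ x := fun x hx => density_nonneg hC₁ hρ hx
  refine le_trans ?_ (en_b_le v t hρ0 (l₀ := l) (l₁ := 0) hl (by omega))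
  have c := hρ.1.continuous'
  have s := (hv.pdt_iter l).smoothFn t
  have c1 := s.gradSq_cont
  have c2 := (s.pd1_iter 1).gradSq_cont
  apply intO_mono (by fun_prop)
  · simp only [Function.iterate_zero, id_eq, zero_add]
    fun_prop
  · intro x hx
    simp only [Function.iterate_zero, id_eq, zero_add]
    apply mul_le_mul_of_nonneg_left _ (hρ0 x hx)
    linarith [gradSq_nonneg (pd1^[1] ((pdt^[l] v) t)) x]

lemma abs_est {ρ d0 d1 H0 H1 g2 g3 : ℝ × ℝ → ℝ} (cr : Continuous ρ) (cd0 : Continuous d0)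
    (cd1 : Continuous d1) (cH0 : Continuous H0) (cH1 : Continuous H1) (c2 : Continuous g2)
    (c3 : Continuous g3) {c K E : ℝ} (hc : 0 ≤ c)
    (h : ∀ x ∈ Oset, ρ x * (-(d0 x * H0 x) - d1 x * H1 x) ≤
      - (1 / 4) * (ρ x * (d0 x ^ 2 + d1 x ^ 2)) + c * (K + (ρ x * g2 x + ρ x * g3 x)))
    (h2 : ∫ x in Oset, ρ x * g2 x ≤ E) (h3 : ∫ x in Oset, ρ x * g3 x ≤ E) :
    ∫ x in Oset, ρ x * (-(d0 x * H0 x) - d1 x * H1 x) ≤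
      (∫ x in Oset, - (1 / 4) * (ρ x * (d0 x ^ 2 + d1 x ^ 2))) + c * (K + 2 * E) := by
  refine (intO_mono (by fun_prop) (by fun_prop) h).trans ?_
  rw [intO_add (by fun_prop) (by fun_prop)]
  have e4 : ∫ x in Oset, c * (K + (ρ x * g2 x + ρ x * g3 x)) = c *
      (K + ((∫ x in Oset, ρ x * g2 x) + ∫ x in Oset, ρ x * g3 x)) := by
    rw [integral_const_mul, intO_add (by fun_prop) (by fun_prop), intO_const,
      intO_add (by fun_prop) (by fun_prop)]
  rw [e4]
  have := mul_le_mul_of_nonneg_left (by linarith : K + ((∫ x in Oset, ρ x * g2 x) +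
    ∫ x in Oset, ρ x * g3 x) ≤ K + 2 * E) hc
  linarith

lemma ptwise2 {a b F0 F1 f0 f1 c r K q2 q3 : ℝ} (h : 1 / 2 * (a ^ 2 + b ^ 2) ≤ a * f0 + b * f1)
    (h0 : |F0 - f0| ≤ c * bt (√q2) (√q3) 4) (h1 : |F1 - f1| ≤ c * bt (√q2) (√q3) 4)
    (hr : 0 ≤ r) (hK : r ≤ K) (hq2 : 0 ≤ q2) (hq3 : 0 ≤ q3) :
    r * (-(a * F0) - b * F1) ≤ - (1 / 4) * (r * (a ^ 2 + b ^ 2)) +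
      6 * c ^ 2 * (K + (r * q2 + r * q3)) := by
  have key := ptwise h h0 h1
  have hb := bt4_sq (m2 := √q2) (m3 := √q3)
  rw [Real.sq_sqrt hq2, Real.sq_sqrt hq3] at hb
  rw [mul_pow] at key
  have key2 := key.trans (add_le_add_right (mul_le_mul_of_nonneg_left
      (mul_le_mul_of_nonneg_left hb (sq_nonneg c)) (by norm_num : (0:ℝ) ≤ 2)) _)
  have key3 := mul_le_mul_of_nonneg_left key2 hr
  have k4 : 6 * c ^ 2 * r ≤ 6 * c ^ 2 * K :=
    mul_le_mul_of_nonneg_left hK (by positivity)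
  linarith

lemma diff_ineq (hC₁ : 0 < C₁) (hC₂ : 0 < C₂) (hρ : IsDensity C₁ C₂ ρ) (hv : SmoothT v)
    (pv : PerT v) (hA : Apriori ρ v T M₁ c₁ c₂) (hS : IsLagSol ρ v T)
    {s Z : ℝ} (hs0 : 0 < s) (hsT : s < T) (hZ : 0 ≤ Z) (hE : energy ρ v s ≤ Z ^ 2) (i : Fin 2) :
    ∫ x in Oset, ρ x * (pdt^[4] (vcmp i v) s x * pdt (pdt^[4] (vcmp i v)) s x) ≤
      (∫ x in Oset, - (1 / 4) * (ρ x * (sdir (evec 0) (pdt^[4] (vcmp i v)) s x ^ 2 +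
        sdir (evec 1) (pdt^[4] (vcmp i v)) s x ^ 2)))
      + 6 * Cr C₁ C₂ Z ^ 2 * (C₂ + 2 * Z ^ 2) := by
  have hρ0 : ∀ x ∈ Oset, 0 ≤ ρ x := fun x hx => density_nonneg hC₁ hρ hx
  have sW := (hv.vcmp i).pdt_iter 4
  have sH := fun k => (Hd_smooth hρ.1 hv i k).pdt_iter 4
  have pW := perT_pdt_iter (perT_vcmp pv i) 4
  have pH := fun k => perT_pdt_iter (perT_Hd hρ.2.1 pv i k) 4
  have hW := smoothFn_iff.1 (sW.smoothFn s)
  have hH := fun k => smoothFn_iff.1 ((sH k).smoothFn s)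
  set W := (pdt^[4] (vcmp i v)) s with hWd
  set H := fun k => (pdt^[4] (Hd ρ v i k)) s with hHd
  have hr := smoothFn_iff.1 hρ.1
  have cr := hr.continuous
  have cW := hW.continuous
  have cH0 := (hH 0).continuous
  have cH1 := (hH 1).continuous
  have cd := fun k => (contDiff_dir hW (evec k)).continuous
  have cd0 := cd 0
  have cd1 := cd 1
  have s2 := ((hv.pdt_iter 2).smoothFn s).gradSq_cont
  have s3 := ((hv.pdt_iter 3).smoothFn s).gradSq_cont
  rw [ibp2 hρ hW (hH 0) (hH 1) (pW s) (pH 0 s) (pH 1 s) (Wt := pdt (pdt^[4] (vcmp i v)) s) (by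
    intro x hx
    have := pde4 hρ hv hA hS hs0 hsT hx i
    rw [Fin.sum_univ_two] at this
    exact this)]
  refine abs_est cr (cd 0) (cd 1) cH0 cH1 s2 s3 (by positivity) ?_
    ((grad_energy hC₁ hρ hv s (l := 2) (by norm_num)).trans hE)
    ((grad_energy hC₁ hρ hv s (l := 3) (by norm_num)).trans hE)
  intro x hx
  have hX := Xd_close hv hA ⟨hs0.le, hsT.le⟩ hx
  have hJ : ∀ᶠ τ in nhds s, 1 / 2 ≤ Jd v τ x := by
    filter_upwards [Ioo_mem_nhds hs0 hsT] with τ hτ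
    have := (Jd_bounds (Xd_close hv hA ⟨hτ.1.le, hτ.2.le⟩ hx)).1
    linarith
  have hrem := rem_le hv (Real.sqrt_nonneg (gradSq ((pdt^[2] v) s) x))
    (Real.sqrt_nonneg (gradSq ((pdt^[3] v) s) x)) (hρ0 x hx) (density_le hC₂ hρ hx)
    le_rfl le_rfl (L := Kc C₁ * (1 + Z)) (by nlinarith [Kc_ge hC₁])
    (fun l hl i j => sup_L hC₁ hρ hv hZ hE hx l hl i j) hX hJ i
  rw [← Cr] at hrem
  exact ptwise2 (Phi_coercive hX (sdir (evec 0) (pdt^[4] (vcmp i v)) s x)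
    (sdir (evec 1) (pdt^[4] (vcmp i v)) s x)) (hrem 0) (hrem 1) (hρ0 x hx)
    (density_le hC₂ hρ hx) (gradSq_nonneg _ _) (gradSq_nonneg _ _)

lemma est4 (hC₁ : 0 < C₁) (hC₂ : 0 < C₂) (hρ : IsDensity C₁ C₂ ρ) (hv : SmoothT v)
    (pv : PerT v) (hA : Apriori ρ v T M₁ c₁ c₂) (hS : IsLagSol ρ v T)
    {t Z : ℝ} (ht0 : 0 ≤ t) (htT : t ≤ T) (hZ : 0 ≤ Z)
    (hE : ∀ s ∈ Set.Icc (0:ℝ) t, energy ρ v s ≤ Z ^ 2) (i : Fin 2) :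
    (∫ x in Oset, ρ x * (pdt^[4] (vcmp i v) t x) ^ 2) +
      1 / 2 * (∫ s in (0:ℝ)..t, ∫ x in Oset,
        ρ x * (sdir (evec 0) (pdt^[4] (vcmp i v)) s x ^ 2 +
          sdir (evec 1) (pdt^[4] (vcmp i v)) s x ^ 2)) ≤
    (∫ x in Oset, ρ x * (pdt^[4] (vcmp i v) 0 x) ^ 2)
      + t * (12 * Cr C₁ C₂ Z ^ 2 * (C₂ + 2 * Z ^ 2)) := by
  have sW := (hv.vcmp i).pdt_iter 4
  set W := pdt^[4] (vcmp i v) with hWd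
  have sf : SmoothT (fun t x => ρ x * (W t x * W t x)) := hρ.1.smoothT.mulS (sW.mulS sW)
  have hft := time_ftc sf ht0
  have ep : ∀ s x, pdt (fun t x => ρ x * (W t x * W t x)) s x =
      2 * (ρ x * (W s x * pdt W s x)) := by
    intro s x
    have hd : HasDerivAt (fun s => W s x) (pdt W s x) s :=
      ((sW.contDiff_time x).differentiable (by simp) s).hasDerivAt
    have := ((hd.mul hd).const_mul (ρ x)).deriv
    unfold pdt
    unfold pdt at this
    refine this.trans ?_
    ring
  simp only [ep] at hft
  have sg : SmoothT (fun s x => ρ x * (sdir (evec 0) W s x * sdir (evec 0) W s x +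
      sdir (evec 1) W s x * sdir (evec 1) W s x)) :=
    hρ.1.smoothT.mulS (((sW.sdir (evec 0)).mulS (sW.sdir (evec 0))).addS
      ((sW.sdir (evec 1)).mulS (sW.sdir (evec 1))))
  have cg := cont_intO (f := fun s x => ρ x * (sdir (evec 0) W s x * sdir (evec 0) W s x +
      sdir (evec 1) W s x * sdir (evec 1) W s x)) sg.continuous
  have cl := cont_intO (f := fun s x => ρ x * (W s x * pdt W s x)) (hρ.1.smoothT.mulS (sW.mulS sW.pdt)).continuous
  simp only [← pow_two] at hft cg
  set B := 6 * Cr C₁ C₂ Z ^ 2 * (C₂ + 2 * Z ^ 2) with hB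
  have hmono : ∫ s in (0:ℝ)..t, ∫ x in Oset, 2 * (ρ x * (W s x * pdt W s x)) ≤
      ∫ s in (0:ℝ)..t, (2 * B - 1 / 2 * ∫ x in Oset, ρ x * (sdir (evec 0) W s x ^ 2 +
          sdir (evec 1) W s x ^ 2)) := by
    apply intervalIntegral.integral_mono_on_of_le_Ioo ht0
    · simp only [integral_const_mul]
      exact (continuous_const.mul cl).intervalIntegrable _ _
    · exact (continuous_const.sub (continuous_const.mul cg)).intervalIntegrable _ _
    · intro s hs
      have := diff_ineq hC₁ hC₂ hρ hv pv hA hS hs.1 (hs.2.trans_le htT) hZ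
        (hE s ⟨hs.1.le, hs.2.le⟩) i
      rw [integral_const_mul] at this ⊢
      linarith
  rw [intervalIntegral.integral_sub (by simp)
    ((continuous_const.fun_mul cg).intervalIntegrable _ _), intervalIntegral.integral_const,
    intervalIntegral.integral_const_mul] at hmono
  simp only [sub_zero, smul_eq_mul] at hmono
  rw [hft]
  have : t * (12 * Cr C₁ C₂ Z ^ 2 * (C₂ + 2 * Z ^ 2)) = t * (2 * B) := by rw [hB]; ring
  rw [this]
  linarith

lemma pick_energy (hC₁ : 0 < C₁) (hρ : IsDensity C₁ C₂ ρ) (hv : SmoothT v) (t : ℝ) (l : ℕ)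
    (i : Fin 2) :
    ∫ x in Oset, ρ x * (pdt^[l] (vcmp i v) t x) ^ 2 ≤ ∫ x in Oset, ρ x * ‖(pdt^[l] v) t x‖ ^ 2 := by
  have hρ0 : ∀ x ∈ Oset, 0 ≤ ρ x := fun x hx => density_nonneg hC₁ hρ hx
  have c := hρ.1.continuous'
  have c1 := (((hv.vcmp i).pdt_iter l).smoothFn t).continuous'
  have c2 := ((hv.pdt_iter l).smoothFn t).continuous'
  apply intO_mono (by fun_prop) (by fun_prop)
  intro x hx
  apply mul_le_mul_of_nonneg_left _ (hρ0 x hx)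
  rw [pdt_iter_cmp hv, ← sq_abs]
  exact pow_le_pow_left₀ (abs_nonneg _) (abs_pick_le _ _) 2

lemma energy_pick (hC₁ : 0 < C₁) (hρ : IsDensity C₁ C₂ ρ) (hv : SmoothT v) (t : ℝ) (l : ℕ) :
    ∫ x in Oset, ρ x * ‖(pdt^[l] v) t x‖ ^ 2 ≤
      (∫ x in Oset, ρ x * (pdt^[l] (vcmp 0 v) t x) ^ 2) +
      ∫ x in Oset, ρ x * (pdt^[l] (vcmp 1 v) t x) ^ 2 := by
  have hρ0 : ∀ x ∈ Oset, 0 ≤ ρ x := fun x hx => density_nonneg hC₁ hρ hx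
  have c := hρ.1.continuous'
  have c1 := (((hv.vcmp 0).pdt_iter l).smoothFn t).continuous'
  have c3 := (((hv.vcmp 1).pdt_iter l).smoothFn t).continuous'
  have c2 := ((hv.pdt_iter l).smoothFn t).continuous'
  rw [← intO_add (by fun_prop) (by fun_prop)]
  apply intO_mono (by fun_prop) (by fun_prop)
  intro x hx
  rw [← mul_add]
  apply mul_le_mul_of_nonneg_left _ (hρ0 x hx)
  rw [pdt_iter_cmp hv, pdt_iter_cmp hv]
  exact norm_sq_le_pick _

lemma est_low (hC₁ : 0 < C₁) (hρ : IsDensity C₁ C₂ ρ) (hv : SmoothT v)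
    {t Z : ℝ} (ht0 : 0 ≤ t)
    (hE : ∀ s ∈ Set.Icc (0:ℝ) t, energy ρ v s ≤ Z ^ 2) (i : Fin 2) {l : ℕ} (hl : l < 4) :
    (∫ x in Oset, ρ x * (pdt^[l] (vcmp i v) t x) ^ 2) ≤
    energy ρ v 0 + t * (2 * Z ^ 2) := by
  have hρ0 : ∀ x ∈ Oset, 0 ≤ ρ x := fun x hx => density_nonneg hC₁ hρ hx
  have h0 := (pick_energy hC₁ hρ hv 0 l i).trans (en_a_le v 0 hρ0 (by omega))
  have hbd : ∀ s ∈ Set.Icc (0:ℝ) t, ∀ m < 5,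
      ∫ x in Oset, ρ x * (pdt^[m] (vcmp i v) s x) ^ 2 ≤ Z ^ 2 := fun s hs m hm =>
    ((pick_energy hC₁ hρ hv s m i).trans (en_a_le v s hρ0 hm)).trans (hE s hs)
  have hb1 := fun s hs => hbd s hs l (by omega)
  have hb2 := fun s hs => hbd s hs (l + 1) (by omega)
  simp only [Function.iterate_succ_apply'] at hb2
  have sW := (hv.vcmp i).pdt_iter l
  set W := pdt^[l] (vcmp i v) with hWd
  have sf : SmoothT (fun t x => ρ x * (W t x * W t x)) := hρ.1.smoothT.mulS (sW.mulS sW)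
  have hft := time_ftc sf ht0
  have ep : ∀ s x, pdt (fun t x => ρ x * (W t x * W t x)) s x =
      2 * (ρ x * (W s x * pdt W s x)) := by
    intro s x
    have hd : HasDerivAt (fun s => W s x) (pdt W s x) s :=
      ((sW.contDiff_time x).differentiable (by simp) s).hasDerivAt
    have := ((hd.mul hd).const_mul (ρ x)).deriv
    unfold pdt
    unfold pdt at this
    refine this.trans ?_
    ring
  simp only [ep] at hft
  simp only [← pow_two] at hft
  have cl := cont_intO (f := fun s x => ρ x * (W s x * pdt W s x)) (hρ.1.smoothT.mulS (sW.mulS sW.pdt)).continuous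
  have hmono : ∫ s in (0:ℝ)..t, ∫ x in Oset, 2 * (ρ x * (W s x * pdt W s x)) ≤
      ∫ s in (0:ℝ)..t, 2 * Z ^ 2 := by
    apply intervalIntegral.integral_mono_on ht0
    · simp only [integral_const_mul]
      exact (continuous_const.mul cl).intervalIntegrable _ _
    · simp
    · intro s hs
      have c := hρ.1.continuous'
      have c1 := (sW.smoothFn s).continuous'
      have c2 := (sW.pdt.smoothFn s).continuous'
      have : ∫ x in Oset, 2 * (ρ x * (W s x * pdt W s x)) ≤
          ∫ x in Oset, (ρ x * W s x ^ 2 + ρ x * pdt W s x ^ 2) := by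
        apply intO_mono (by fun_prop) (by fun_prop)
        intro x hx
        nlinarith [mul_nonneg (hρ0 x hx) (sq_nonneg (W s x - pdt W s x))]
      rw [intO_add (by fun_prop) (by fun_prop)] at this
      linarith [hb1 s hs, hb2 s hs]
  rw [intervalIntegral.integral_const] at hmono
  simp only [sub_zero, smul_eq_mul] at hmono
  linarith

end est

section fin
variable {C₁ C₂ : ℝ} {ρ : ℝ × ℝ → ℝ} {v : ℝ → ℝ × ℝ → ℝ × ℝ} {T M₁ c₁ c₂ : ℝ}

lemma grad_split (hC₁ : 0 < C₁) (hρ : IsDensity C₁ C₂ ρ) (hv : SmoothT v) {t : ℝ} (ht : 0 ≤ t) :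
    (∫ s in (0:ℝ)..t, ∫ x in Oset, ρ x * gradSq ((pdt^[4] v) s) x) ≤
      (∫ s in (0:ℝ)..t, ∫ x in Oset, ρ x * (sdir (evec 0) (pdt^[4] (vcmp 0 v)) s x ^ 2 +
          sdir (evec 1) (pdt^[4] (vcmp 0 v)) s x ^ 2)) +
      ∫ s in (0:ℝ)..t, ∫ x in Oset, ρ x * (sdir (evec 0) (pdt^[4] (vcmp 1 v)) s x ^ 2 +
          sdir (evec 1) (pdt^[4] (vcmp 1 v)) s x ^ 2) := by
  have hρ0 : ∀ x ∈ Oset, 0 ≤ ρ x := fun x hx => density_nonneg hC₁ hρ hx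
  have cr := hρ.1.continuous'
  have sV := hv.pdt_iter 4
  rw [pdt_iter_cmp hv, pdt_iter_cmp hv]
  generalize pdt^[4] v = V at sV ⊢
  have key : ∀ i : Fin 2, Continuous fun p : ℝ × (ℝ × ℝ) =>
      ρ p.2 * (sdir (evec 0) (vcmp i V) p.1 p.2 ^ 2 + sdir (evec 1) (vcmp i V) p.1 p.2 ^ 2) := by
    intro i
    have a0 := ((sV.vcmp i).sdir (evec 0)).continuous
    have a1 := ((sV.vcmp i).sdir (evec 1)).continuous
    exact (cr.comp continuous_snd).fun_mul ((a0.pow 2).add (a1.pow 2))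
  have keyG : Continuous fun p : ℝ × (ℝ × ℝ) => ρ p.2 * gradSq (V p.1) p.2 := by
    have a0 := (sV.sdir (1, 0)).continuous
    have a1 := (sV.sdir (0, 1)).continuous
    exact (cr.comp continuous_snd).fun_mul ((a0.norm.pow 2).add (a1.norm.pow 2))
  have k0 := cont_intO (f := fun s x => ρ x * (sdir (evec 0) (vcmp 0 V) s x ^ 2 +
    sdir (evec 1) (vcmp 0 V) s x ^ 2)) (key 0)
  have k1 := cont_intO (f := fun s x => ρ x * (sdir (evec 0) (vcmp 1 V) s x ^ 2 +
    sdir (evec 1) (vcmp 1 V) s x ^ 2)) (key 1)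
  have kG := cont_intO (f := fun s x => ρ x * gradSq (V s) x) keyG
  rw [← intervalIntegral.integral_add (k0.intervalIntegrable _ _) (k1.intervalIntegrable _ _)]
  apply intervalIntegral.integral_mono_on ht (kG.intervalIntegrable _ _)
    ((k0.add k1).intervalIntegrable _ _)
  intro s _
  have sl : Continuous fun x : ℝ × ℝ => ((s, x) : ℝ × (ℝ × ℝ)) := by fun_prop
  have q0 := (key 0).comp sl
  have q1 := (key 1).comp sl
  have qG := keyG.comp sl
  refine le_trans ?_ (intO_add q0 q1).le
  apply intO_mono qG (q0.add q1)
  intro x hx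
  change ρ x * gradSq (V s) x ≤
    ρ x * (sdir (evec 0) (vcmp 0 V) s x ^ 2 + sdir (evec 1) (vcmp 0 V) s x ^ 2) +
    ρ x * (sdir (evec 0) (vcmp 1 V) s x ^ 2 + sdir (evec 1) (vcmp 1 V) s x ^ 2)
  rw [← mul_add]
  apply mul_le_mul_of_nonneg_left _ (hρ0 x hx)
  rw [sdir_cmp sV, sdir_cmp sV, sdir_cmp sV, sdir_cmp sV]
  have e0 := norm_sq_le_pick (sdir (evec 0) V s x)
  have e1 := norm_sq_le_pick (sdir (evec 1) V s x)
  have g : gradSq (V s) x = ‖sdir (evec 0) V s x‖ ^ 2 + ‖sdir (evec 1) V s x‖ ^ 2 := rfl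
  rw [g]
  unfold vcmp
  linarith

lemma supEn_spec (hC₁ : 0 < C₁) (hρ : IsDensity C₁ C₂ ρ) (hA : Apriori ρ v T M₁ c₁ c₂) {t : ℝ}
    (htT : t ≤ T) : 0 ≤ supEn ρ v t ∧ ∀ s ∈ Set.Icc (0:ℝ) t, energy ρ v s ≤ supEn ρ v t ^ 2 := by
  have hρ0 : ∀ x ∈ Oset, 0 ≤ ρ x := fun x hx => density_nonneg hC₁ hρ hx
  obtain ⟨-, -, -, -, -, -, hE, -⟩ := hA
  have hbdd : BddAbove (Set.range fun s : Set.Icc (0:ℝ) t => Real.sqrt (energy ρ v ↑s)) := by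
    refine ⟨Real.sqrt M₁, ?_⟩
    rintro _ ⟨s, rfl⟩
    exact Real.sqrt_le_sqrt (hE s ⟨s.2.1, s.2.2.trans htT⟩)
  refine ⟨Real.iSup_nonneg fun s => Real.sqrt_nonneg _, fun s hs => ?_⟩
  have h := le_ciSup hbdd ⟨s, hs⟩
  have h2 := pow_le_pow_left₀ (Real.sqrt_nonneg _) h 2
  simp only at h2
  rw [Real.sq_sqrt (energy_nonneg v s hρ0)] at h2
  exact h2

lemma const_bd (hC₁ : 0 < C₁) (hC₂ : 0 < C₂) {Z : ℝ} (hZ : 0 ≤ Z) :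
    16 * Z ^ 2 + 4 * (12 * Cr C₁ C₂ Z ^ 2 * (C₂ + 2 * Z ^ 2)) ≤
      (16 + 48 * (2 ^ 200 * (1 + C₂) ^ 2 * Kc C₁ ^ 38) * (2 + C₂)) * (1 + Z) ^ 40 := by
  have hK := Kc_ge hC₁
  have h1 : Cr C₁ C₂ Z ^ 2 = (2 ^ 200 * (1 + C₂) ^ 2 * Kc C₁ ^ 38) * (1 + Z) ^ 38 := by
    unfold Cr
    rw [mul_pow, mul_pow, ← pow_mul, ← pow_mul, mul_pow]
    norm_num
    ring
  rw [h1]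
  have hA : 0 ≤ 2 ^ 200 * (1 + C₂) ^ 2 * Kc C₁ ^ 38 := by positivity
  generalize 2 ^ 200 * (1 + C₂) ^ 2 * Kc C₁ ^ 38 = A at hA ⊢
  have h2 : C₂ + 2 * Z ^ 2 ≤ (2 + C₂) * (1 + Z) ^ 2 := by nlinarith [mul_nonneg hC₂.le hZ, mul_nonneg hC₂.le (sq_nonneg Z)]
  have h3 : Z ^ 2 ≤ (1 + Z) ^ 40 :=
    calc Z ^ 2 ≤ (1 + Z) ^ 2 := by gcongr; linarith
      _ ≤ (1 + Z) ^ 40 := pow_le_pow_right₀ (by linarith) (by norm_num)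
  have h4 : A * (1 + Z) ^ 38 * (C₂ + 2 * Z ^ 2) ≤ A * (1 + Z) ^ 38 * ((2 + C₂) * (1 + Z) ^ 2) :=
    mul_le_mul_of_nonneg_left h2 (by positivity)
  have h5 : A * (1 + Z) ^ 38 * ((2 + C₂) * (1 + Z) ^ 2) = A * (2 + C₂) * (1 + Z) ^ 40 := by
    rw [show (40:ℕ) = 38 + 2 from rfl, pow_add]; ring
  rw [h5] at h4
  have e : (16 + 48 * A * (2 + C₂)) * (1 + Z) ^ 40 =
    16 * (1 + Z) ^ 40 + 48 * (A * (2 + C₂) * (1 + Z) ^ 40) := by ring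
  rw [e]
  linarith

lemma final_est (hC₁ : 0 < C₁) (hC₂ : 0 < C₂) (hρ : IsDensity C₁ C₂ ρ) (hv : SmoothT v)
    (pv : PerT v) (hS : IsLagSol ρ v T) (hA : Apriori ρ v T M₁ c₁ c₂)
    {t : ℝ} (ht0 : 0 ≤ t) (htT : t ≤ T) :
    (∑ l₀ ∈ Finset.range 5, ∫ x in Oset, ρ x * ‖(pdt^[l₀] v) t x‖ ^ 2)
        + (∫ s in (0:ℝ)..t, ∫ x in Oset, ρ x * gradSq ((pdt^[4] v) s) x)
      ≤ 12 * energy ρ v 0 +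
        (16 + 48 * (2 ^ 200 * (1 + C₂) ^ 2 * Kc C₁ ^ 38) * (2 + C₂)) * t *
          (1 + supEn ρ v t) ^ 40 := by
  have hρ0 : ∀ x ∈ Oset, 0 ≤ ρ x := fun x hx => density_nonneg hC₁ hρ hx
  obtain ⟨hZ, hE⟩ := supEn_spec hC₁ hρ hA htT
  generalize supEn ρ v t = Z at hZ hE ⊢
  have hlow : ∀ l < 4, ∫ x in Oset, ρ x * ‖(pdt^[l] v) t x‖ ^ 2 ≤
      2 * energy ρ v 0 + t * (4 * Z ^ 2) := by
    intro l hl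
    have a := energy_pick hC₁ hρ hv t l
    have b := est_low hC₁ hρ hv ht0 hE 0 hl
    have c := est_low hC₁ hρ hv ht0 hE 1 hl
    linarith
  have l0 := hlow 0 (by norm_num)
  have l1 := hlow 1 (by norm_num)
  have l2 := hlow 2 (by norm_num)
  have l3 := hlow 3 (by norm_num)
  have hn : ∀ i : Fin 2, 0 ≤ ∫ x in Oset, ρ x * (pdt^[4] (vcmp i v) t x) ^ 2 := fun i =>
    intO_nonneg fun x hx => mul_nonneg (hρ0 x hx) (sq_nonneg _)
  have a4 := energy_pick hC₁ hρ hv t 4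
  have b0 := est4 hC₁ hC₂ hρ hv pv hA hS ht0 htT hZ hE 0
  have b1 := est4 hC₁ hC₂ hρ hv pv hA hS ht0 htT hZ hE 1
  have i0 := (pick_energy hC₁ hρ hv 0 4 0).trans (en_a_le v 0 hρ0 (by norm_num))
  have i1 := (pick_energy hC₁ hρ hv 0 4 1).trans (en_a_le v 0 hρ0 (by norm_num))
  have g := grad_split hC₁ hρ hv ht0
  have n0 := hn 0
  have n1 := hn 1
  have cb := mul_le_mul_of_nonneg_left (const_bd hC₁ hC₂ hZ) ht0
  rw [mul_add] at cb
  generalize (16 + 48 * (2 ^ 200 * (1 + C₂) ^ 2 * Kc C₁ ^ 38) * (2 + C₂)) = CC at cb ⊢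
  generalize 12 * Cr C₁ C₂ Z ^ 2 * (C₂ + 2 * Z ^ 2) = B at *
  rw [show CC * t * (1 + Z) ^ 40 = t * (CC * (1 + Z) ^ 40) by ring]
  generalize t * (CC * (1 + Z) ^ 40) = R at *
  simp only [Finset.sum_range_succ, Finset.sum_range_zero, zero_add]
  linarith

end fin

/-- (Basic tangential energy estimate, Proposition 5.1.)
For smooth solutions of the Lagrangian system satisfying the a priori assumption,
`Σ_{l₀=0}^{4} ∫_Ω ρ₀|∂ₜ^{l₀}v|²(t) dx + ∫₀ᵗ∫_Ω ρ₀|∂ₜ⁴Dv|² dx ds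
  ≤ P₀(E(0,u₀)) + C t P(sup_{0≤s≤t} E(s,v)^{1/2})`. -/
theorem stmt11 (C₁ C₂ R : ℝ) (hC₁ : 0 < C₁) (hC₁₂ : C₁ ≤ C₂) (hR : 0 ≤ R) :
    ∃ C > (0:ℝ), ∃ P₀ P : Polynomial ℝ,
      (∀ n : ℕ, 0 ≤ P₀.coeff n) ∧ (∀ n : ℕ, 0 ≤ P.coeff n) ∧
      ∀ ρ₀ : ℝ × ℝ → ℝ, IsDensity C₁ C₂ ρ₀ → sobolevNorm 7 ρ₀ ≤ R →
        ∀ (T M₁ c₁ c₂ : ℝ) (v : ℝ → ℝ × ℝ → ℝ × ℝ),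
          SmoothT v → PerT v → IsLagSol ρ₀ v T → Apriori ρ₀ v T M₁ c₁ c₂ →
          ∀ t ∈ Set.Icc (0:ℝ) T,
            (∑ l₀ ∈ Finset.range 5, ∫ x in Oset, ρ₀ x * ‖(pdt^[l₀] v) t x‖ ^ 2)
                + (∫ s in (0:ℝ)..t, ∫ x in Oset, ρ₀ x * gradSq ((pdt^[4] v) s) x)
              ≤ P₀.eval (energy ρ₀ v 0) + C * t * P.eval (supEn ρ₀ v t) := by
  have hC₂ : 0 < C₂ := hC₁.trans_le hC₁₂
  have hK := Kc_ge hC₁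
  refine ⟨16 + 48 * (2 ^ 200 * (1 + C₂) ^ 2 * Kc C₁ ^ 38) * (2 + C₂), by positivity,
    Polynomial.C 12 * Polynomial.X, (1 + Polynomial.X) ^ 40, ?_, ?_, ?_⟩
  · intro n
    rw [Polynomial.coeff_C_mul, Polynomial.coeff_X]
    split_ifs <;> norm_num
  · intro n
    rw [Polynomial.coeff_one_add_X_pow]
    positivity
  · intro ρ hρ _ T M₁ c₁ c₂ v hv pv hS hA t ht
    have h := final_est hC₁ hC₂ hρ hv pv hS hA ht.1 ht.2
    simp only [Polynomial.eval_mul, Polynomial.eval_C, Polynomial.eval_X, Polynomial.eval_pow,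
      Polynomial.eval_add, Polynomial.eval_one]
    exact h
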